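/- Let b(a) denote the least integer b > a such that v_{a,b} < v_{a,b-1} (such b exists for every a). Then liminf_{a→∞} (b(a) − a)/log a ≤ t(t+1)φ(t), where φ is Euler's totient function. Moreover, if t > 1 and r_i ≠ 0 for all i with gcd(i, t) = 1, then liminf_{a→∞} (b(a) − a)/log a < 20·log(log(2t)); and if r_i ≠ 0 for all i, then liminf_{a→∞} (b(a) − a)/log a ≤ 2. -/

import Mathlib

open Finset Filter

/-- `Lab r a b` is the least common multiple of those `i ∈ {a,…,b}` with `r i ≠ 0`
(equal to `1` if there are none). -/
def Lab (r : ℕ → ℤ) (a b : ℕ) : ℕ :=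
  ((Finset.Icc a b).filter fun i => r i ≠ 0).lcm id

/-- `Xab r a b = L_{a,b} · Σ_{i=a}^b r_i / i`, as an integer. -/
def Xab (r : ℕ → ℤ) (a b : ℕ) : ℤ :=
  ∑ i ∈ Finset.Icc a b, r i * ((Lab r a b / i : ℕ) : ℤ)

def gab (r : ℕ → ℤ) (a b : ℕ) : ℕ :=
  Int.gcd (Xab r a b) (Lab r a b)

/-- `vab r a b` is the denominator of `Σ_{i=a}^b r_i / i` in lowest terms. -/
def vab (r : ℕ → ℤ) (a b : ℕ) : ℕ :=
  Lab r a b / gab r a b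

/-- `bfun r a` is the least `b > a` with `v_{a,b} < v_{a,b-1}`. -/
noncomputable def bfun (r : ℕ → ℤ) (a : ℕ) : ℕ :=
  sInf {b : ℕ | a < b ∧ vab r a b < vab r a (b - 1)}

section FejerKernel
open MeasureTheory Topology

/-- The Fejér kernel on the real line. -/
noncomputable def fejer (w : ℝ) : ℝ := Real.sinc (w / 2) ^ 2

lemma fejer_nonneg (w : ℝ) : 0 ≤ fejer w := sq_nonneg _

lemma continuous_fejer : Continuous fejer := by
  unfold fejer
  exact (Real.continuous_sinc.comp (continuous_id.div_const 2)).pow 2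

lemma fejer_of_ne_zero {w : ℝ} (hw : w ≠ 0) : fejer w = 2 * (1 - Real.cos w) / w ^ 2 := by
  have h : Real.cos w = 1 - 2 * Real.sin (w / 2) ^ 2 := by
    have := Real.cos_two_mul (w / 2)
    have h2 := Real.sin_sq_add_cos_sq (w / 2)
    rw [show 2 * (w / 2) = w by ring] at this
    linarith
  rw [fejer, Real.sinc_of_ne_zero (by simpa using hw), h]
  field_simp
  ring

lemma fejer_le (w : ℝ) : fejer w ≤ 5 * (1 + w ^ 2)⁻¹ := by
  have h1 : fejer w ≤ 1 := by
    have := Real.abs_sinc_le_one (w / 2)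
    rw [fejer, ← sq_abs]
    exact pow_le_one₀ (abs_nonneg _) this
  have h2 : w ^ 2 * fejer w ≤ 4 := by
    rcases eq_or_ne w 0 with rfl | hw
    · simp
    · rw [fejer_of_ne_zero hw]
      have := Real.neg_one_le_cos w
      field_simp
      linarith
  rw [← div_eq_mul_inv, le_div_iff₀ (by positivity)]
  linarith

lemma integrable_fejer : Integrable fejer := by
  refine (integrable_inv_one_add_sq.const_mul 5).mono'
    continuous_fejer.aestronglyMeasurable (ae_of_all _ fun w => ?_)
  rw [Real.norm_of_nonneg (fejer_nonneg w)]
  exact fejer_le w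

lemma integral_fejer_pos : 0 < ∫ w, fejer w := by
  rw [integral_pos_iff_support_of_nonneg fejer_nonneg integrable_fejer]
  refine continuous_fejer.isOpen_support.measure_pos _ ⟨0, ?_⟩
  simp [fejer]

lemma integral_one_sub_mul_cos (w : ℝ) :
    ∫ y in (0 : ℝ)..1, 2 * ((1 - y) * Real.cos (w * y)) = fejer w := by
  rcases eq_or_ne w 0 with rfl | hw
  · rw [intervalIntegral.integral_const_mul]
    simp only [zero_mul, Real.cos_zero, mul_one]
    rw [intervalIntegral.integral_sub (by simp) (by simp)]
    simp [fejer]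
    norm_num
  · have hd : ∀ y ∈ Set.uIcc (0 : ℝ) 1, HasDerivAt
        (fun y => 2 * ((1 - y) * (Real.sin (w * y) / w) - Real.cos (w * y) / w ^ 2))
        (2 * ((1 - y) * Real.cos (w * y))) y := by
      intro y _
      have hl : HasDerivAt (fun y => w * y) w y := by simpa using (hasDerivAt_id y).const_mul w
      have h1 : HasDerivAt (fun y : ℝ => 1 - y) (-1) y := by
        simpa using (hasDerivAt_id y).const_sub 1
      refine (((h1.mul (hl.sin.div_const w)).sub
        (hl.cos.div_const (w ^ 2))).const_mul 2).congr_deriv ?_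
      field_simp
      ring
    rw [intervalIntegral.integral_eq_sub_of_hasDerivAt hd (by
      apply Continuous.intervalIntegrable; fun_prop), fejer_of_ne_zero hw]
    simp
    field_simp
    ring

lemma integral_triangle_mul_exp (w : ℝ) :
    ∫ y in (-1 : ℝ)..1, ((1 - |y| : ℝ) : ℂ) * Complex.exp (Complex.I * w * y) = fejer w := by
  have hc : Continuous fun y : ℝ => ((1 - |y| : ℝ) : ℂ) * Complex.exp (Complex.I * w * y) := by
    fun_prop
  rw [← intervalIntegral.integral_add_adjacent_intervals (b := 0)
    (hc.intervalIntegrable _ _) (hc.intervalIntegrable _ _)]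
  have h := intervalIntegral.integral_comp_neg
    (f := fun y : ℝ => ((1 - |y| : ℝ) : ℂ) * Complex.exp (Complex.I * w * y)) (a := 0) (b := 1)
  rw [neg_zero] at h
  rw [← h, ← intervalIntegral.integral_add
    (by apply Continuous.intervalIntegrable; fun_prop) (hc.intervalIntegrable _ _),
    ← integral_one_sub_mul_cos, ← intervalIntegral.integral_ofReal]
  refine intervalIntegral.integral_congr fun y hy => ?_
  rw [Set.uIcc_of_le zero_le_one] at hy
  simp only [abs_neg, abs_of_nonneg hy.1]
  push_cast
  rw [Complex.cos]
  have e1 : Complex.I * (w : ℂ) * -(y : ℂ) = -(w * y : ℂ) * Complex.I := by ring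
  have e2 : Complex.I * (w : ℂ) * (y : ℂ) = (w * y : ℂ) * Complex.I := by ring
  rw [e1, e2]
  ring

end FejerKernel

section FejerLaplace
open MeasureTheory Topology

lemma integral_mul_exp_mul_fejer {D : ℝ → ℝ} {M : ℝ} (hD : Measurable D) (hM : ∀ u, |D u| ≤ M)
    {G : ℂ → ℂ}
    (hG : ∀ z : ℂ, 0 < z.re → ∫ u in Set.Ioi (0 : ℝ), (D u : ℂ) * Complex.exp (-u * z) = G z)
    {δ : ℝ} (hδ : 0 < δ) (l T : ℝ) :
    ∫ u in Set.Ioi (0 : ℝ), (D u : ℂ) * Complex.exp (-u * δ) * fejer (l * (T - u)) =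
      ∫ y in (-1 : ℝ)..1, ((1 - |y| : ℝ) : ℂ) * Complex.exp (Complex.I * (l * T : ℝ) * y) *
        G (δ + Complex.I * l * y) := by
  have hint : Integrable (Function.uncurry fun (u y : ℝ) => (D u : ℂ) * Complex.exp (-u * δ) *
      (((1 - |y| : ℝ) : ℂ) * Complex.exp (Complex.I * (l * (T - u) : ℝ) * y)))
      ((volume.restrict (Set.Ioi (0 : ℝ))).prod (volume.restrict (Set.Ioc (-1 : ℝ) 1))) := by
    have h1 : Integrable (fun u : ℝ => M * Real.exp (-δ * u)) (volume.restrict (Set.Ioi 0)) :=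
      (integrableOn_exp_mul_Ioi (by linarith : -δ < 0) 0).const_mul M
    have h2 : Integrable (fun _ : ℝ => (1 : ℝ)) (volume.restrict (Set.Ioc (-1 : ℝ) 1)) := by
      simp
    refine (h1.mul_prod h2).mono' ?_ ?_
    · apply Measurable.aestronglyMeasurable
      unfold Function.uncurry
      fun_prop
    · rw [Measure.prod_restrict]
      refine (ae_restrict_iff' (measurableSet_Ioi.prod measurableSet_Ioc)).2
        (ae_of_all _ fun x hx => ?_)
      obtain ⟨u, y⟩ := x
      have hy : |y| ≤ 1 := abs_le.2 ⟨hx.2.1.le, hx.2.2⟩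
      simp only [Function.uncurry, norm_mul, mul_one, Complex.norm_real, Real.norm_eq_abs,
        Complex.norm_exp]
      have e1 : (-(u : ℂ) * δ).re = -δ * u := by simp; ring
      have e2 : (Complex.I * ((l * (T - u) : ℝ) : ℂ) * y).re = 0 := by simp
      rw [e1, e2, Real.exp_zero, mul_one]
      have h3 : abs (1 - |y|) ≤ 1 := by
        rw [abs_le]; constructor <;> linarith [abs_nonneg y]
      calc |D u| * Real.exp (-δ * u) * abs (1 - |y|) ≤ |D u| * Real.exp (-δ * u) * 1 := by gcongr
        _ ≤ M * Real.exp (-δ * u) := by rw [mul_one]; gcongr; exact hM u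
  calc _ = ∫ u in Set.Ioi (0 : ℝ), ∫ y in Set.Ioc (-1 : ℝ) 1, (D u : ℂ) * Complex.exp (-u * δ) *
      (((1 - |y| : ℝ) : ℂ) * Complex.exp (Complex.I * (l * (T - u) : ℝ) * y)) := by
        refine integral_congr_ae (ae_of_all _ fun u => ?_)
        simp only
        rw [← integral_triangle_mul_exp,
          intervalIntegral.integral_of_le (by norm_num), ← integral_const_mul]
    _ = ∫ y in Set.Ioc (-1 : ℝ) 1, ∫ u in Set.Ioi (0 : ℝ), (D u : ℂ) * Complex.exp (-u * δ) *
      (((1 - |y| : ℝ) : ℂ) * Complex.exp (Complex.I * (l * (T - u) : ℝ) * y)) :=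
        integral_integral_swap hint
    _ = _ := by
        rw [intervalIntegral.integral_of_le (by norm_num)]
        refine integral_congr_ae (ae_of_all _ fun y => ?_)
        simp only
        rw [← hG _ (by simpa using hδ), ← integral_const_mul]
        refine integral_congr_ae (ae_of_all _ fun u => ?_)
        simp only
        have : Complex.exp (-u * δ) * Complex.exp (Complex.I * (l * (T - u) : ℝ) * y) =
            Complex.exp (Complex.I * (l * T : ℝ) * y) *
              Complex.exp (-u * (δ + Complex.I * l * y)) := by
          rw [← Complex.exp_add, ← Complex.exp_add]
          congr 1
          push_cast
          ring
        linear_combination (D u : ℂ) * ((1 - |y| : ℝ) : ℂ) * this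

lemma integrable_fejer_comp {l : ℝ} (hl : 0 < l) (T : ℝ) :
    Integrable fun u => fejer (l * (T - u)) :=
  (integrable_fejer.comp_mul_left' hl.ne').comp_sub_left T

lemma integral_mul_fejer {D : ℝ → ℝ} {M : ℝ} (hD : Measurable D) (hM : ∀ u, |D u| ≤ M)
    {G : ℂ → ℂ} (hGc : ContinuousOn G {z | 0 ≤ z.re})
    (hG : ∀ z : ℂ, 0 < z.re → ∫ u in Set.Ioi (0 : ℝ), (D u : ℂ) * Complex.exp (-u * z) = G z)
    {l : ℝ} (hl : 0 < l) (T : ℝ) :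
    ∫ u in Set.Ioi (0 : ℝ), (D u : ℂ) * fejer (l * (T - u)) =
      ∫ y in (-1 : ℝ)..1, ((1 - |y| : ℝ) : ℂ) * Complex.exp (Complex.I * (l * T : ℝ) * y) *
        G (Complex.I * l * y) := by
  have hL : Tendsto (fun δ : ℝ => ∫ u in Set.Ioi (0 : ℝ),
      (D u : ℂ) * Complex.exp (-u * δ) * fejer (l * (T - u))) (𝓝[>] 0)
      (𝓝 (∫ u in Set.Ioi (0 : ℝ), (D u : ℂ) * fejer (l * (T - u)))) := by
    refine tendsto_integral_filter_of_dominated_convergence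
      (fun u => M * fejer (l * (T - u))) ?_ ?_ ?_ ?_
    · have := continuous_fejer.measurable
      refine Eventually.of_forall fun δ => Measurable.aestronglyMeasurable ?_
      fun_prop
    · filter_upwards [self_mem_nhdsWithin] with δ hδ
      refine (ae_restrict_iff' measurableSet_Ioi).2 (ae_of_all _ fun u hu => ?_)
      simp only [norm_mul, Complex.norm_real, Complex.norm_exp, Real.norm_of_nonneg (fejer_nonneg _)]
      have e1 : (-(u : ℂ) * δ).re = -(δ * u) := by simp; ring
      rw [e1]
      have : Real.exp (-(δ * u)) ≤ 1 := by
        rw [Real.exp_le_one_iff]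
        have : 0 < δ * u := mul_pos hδ hu
        linarith
      have h0 := fejer_nonneg (l * (T - u))
      calc ‖D u‖ * Real.exp (-(δ * u)) * fejer (l * (T - u))
          ≤ ‖D u‖ * 1 * fejer (l * (T - u)) := by gcongr
        _ ≤ M * fejer (l * (T - u)) := by rw [mul_one]; gcongr; exact hM u
    · exact ((integrable_fejer_comp hl T).const_mul M).integrableOn
    · refine ae_of_all _ fun u => ?_
      have : Continuous fun δ : ℝ => (D u : ℂ) * Complex.exp (-u * δ) * fejer (l * (T - u)) := by
        fun_prop
      have h := (this.tendsto 0).mono_left (nhdsWithin_le_nhds (s := Set.Ioi 0))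
      simpa using h
  set H : ℂ → ℂ := fun z => G ((max z.re 0 : ℝ) + z.im * Complex.I) with hH
  have hHc : Continuous H := by
    refine hGc.comp_continuous (by fun_prop) fun z => ?_
    simp
  have hHG : ∀ z : ℂ, 0 ≤ z.re → H z = G z := by
    intro z hz
    simp only [hH, max_eq_left hz, Complex.re_add_im]
  have hR : Tendsto (fun δ : ℝ => ∫ y in (-1 : ℝ)..1, ((1 - |y| : ℝ) : ℂ) *
      Complex.exp (Complex.I * (l * T : ℝ) * y) * H (δ + Complex.I * l * y)) (𝓝[>] 0)
      (𝓝 (∫ y in (-1 : ℝ)..1, ((1 - |y| : ℝ) : ℂ) *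
      Complex.exp (Complex.I * (l * T : ℝ) * y) * H ((0 : ℝ) + Complex.I * l * y))) := by
    refine (Continuous.tendsto ?_ 0).mono_left nhdsWithin_le_nhds
    apply intervalIntegral.continuous_parametric_intervalIntegral_of_continuous'
    unfold Function.uncurry
    fun_prop
  have hR' := hR.congr' (f₂ := fun δ : ℝ => ∫ u in Set.Ioi (0 : ℝ),
      (D u : ℂ) * Complex.exp (-u * δ) * fejer (l * (T - u))) (by
    filter_upwards [self_mem_nhdsWithin] with δ hδ
    rw [integral_mul_exp_mul_fejer hD hM hG hδ]
    refine intervalIntegral.integral_congr fun y _ => ?_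
    rw [hHG]
    simpa using le_of_lt hδ)
  rw [tendsto_nhds_unique hL hR']
  refine intervalIntegral.integral_congr fun y _ => ?_
  rw [hHG _ (by simp)]
  simp

lemma tendsto_integral_mul_fejer {D : ℝ → ℝ} {M : ℝ} (hD : Measurable D) (hM : ∀ u, |D u| ≤ M)
    {G : ℂ → ℂ} (hGc : ContinuousOn G {z | 0 ≤ z.re})
    (hG : ∀ z : ℂ, 0 < z.re → ∫ u in Set.Ioi (0 : ℝ), (D u : ℂ) * Complex.exp (-u * z) = G z)
    {l : ℝ} (hl : 0 < l) :
    Tendsto (fun T : ℝ => ∫ u in Set.Ioi (0 : ℝ), D u * fejer (l * (T - u))) atTop (𝓝 0) := by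
  have hRL := Real.tendsto_integral_exp_smul_cocompact (fun y : ℝ =>
    (Set.Ioc (-1 : ℝ) 1).indicator (fun y => ((1 - |y| : ℝ) : ℂ) * G (Complex.I * l * y)) y)
  have ht : Tendsto (fun T : ℝ => -(l / (2 * Real.pi)) * T) atTop (cocompact ℝ) := by
    refine Tendsto.mono_right ?_ (atBot_le_cocompact)
    exact tendsto_id.const_mul_atTop_of_neg (by have := Real.pi_pos; simp; positivity)
  have h := hRL.comp ht
  rw [← Complex.ofReal_zero] at h
  have key : ∀ T : ℝ, ((∫ u in Set.Ioi (0 : ℝ), D u * fejer (l * (T - u)) : ℝ) : ℂ) =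
      ∫ v : ℝ, Real.fourierChar (-(v * (-(l / (2 * Real.pi)) * T))) •
      (Set.Ioc (-1 : ℝ) 1).indicator (fun y => ((1 - |y| : ℝ) : ℂ) * G (Complex.I * l * y)) v := by
    intro T
    rw [← integral_complex_ofReal]
    push_cast
    rw [integral_mul_fejer hD hM hGc hG hl T, intervalIntegral.integral_of_le (by norm_num),
      ← integral_indicator measurableSet_Ioc]
    refine integral_congr_ae (ae_of_all _ fun y => ?_)
    simp only [Set.indicator]
    split_ifs
    · rw [Circle.smul_def, Real.fourierChar_apply, smul_eq_mul]
      have : ((2 * Real.pi * -(y * (-(l / (2 * Real.pi)) * T)) : ℝ) : ℂ) * Complex.I =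
          Complex.I * (l * T : ℝ) * y := by
        have : 2 * Real.pi * -(y * (-(l / (2 * Real.pi)) * T)) = l * T * y := by
          field_simp
        rw [this]
        push_cast
        ring
      rw [this]
      push_cast
      ring
    · simp
  have h2 : Tendsto (fun T : ℝ => ((∫ u in Set.Ioi (0 : ℝ), D u * fejer (l * (T - u)) : ℝ) : ℂ))
      atTop (𝓝 ((0 : ℝ) : ℂ)) := h.congr fun T => (key T).symm
  exact (Complex.continuous_re.tendsto _).comp h2

end FejerLaplace

section Desmoothing
open MeasureTheory Topology

lemma tendsto_setIntegral_fejer {l : ℝ} (hl : 0 < l) :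
    Tendsto (fun T : ℝ => ∫ u in Set.Ioi (0 : ℝ), fejer (l * (T - u))) atTop
      (𝓝 (∫ x, fejer (l * x))) := by
  have h : ∀ T : ℝ, ∫ u in Set.Ioi (0 : ℝ), fejer (l * (T - u)) =
      ∫ x, (Set.Iio T).indicator (fun x => fejer (l * x)) x := by
    intro T
    rw [← integral_indicator measurableSet_Ioi, ← integral_sub_left_eq_self _ volume T]
    refine integral_congr_ae (ae_of_all _ fun x => ?_)
    simp [Set.indicator]
  simp_rw [h]
  refine tendsto_integral_filter_of_dominated_convergence (fun x => fejer (l * x)) ?_ ?_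
    (integrable_fejer.comp_mul_left' hl.ne') ?_
  · have := continuous_fejer.measurable
    refine Eventually.of_forall fun T => Measurable.aestronglyMeasurable ?_
    exact Measurable.indicator (by fun_prop) measurableSet_Iio
  · refine Eventually.of_forall fun T => ae_of_all _ fun x => ?_
    refine (norm_indicator_le_norm_self _ _).trans ?_
    rw [Real.norm_of_nonneg (fejer_nonneg _)]
  · refine ae_of_all _ fun x => ?_
    refine tendsto_const_nhds.congr' ?_
    filter_upwards [eventually_gt_atTop x] with T hT
    simp [Set.indicator, hT]

variable {B : ℝ → ℝ} {M A : ℝ}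

lemma integrableOn_mul_fejer (hB : Measurable B) (hB0 : ∀ u, 0 ≤ B u) (hM : ∀ u, B u ≤ M)
    {l : ℝ} (hl : 0 < l) (T : ℝ) : Integrable fun u => B u * fejer (l * (T - u)) := by
  refine ((integrable_fejer_comp hl T).const_mul M).mono' ?_ (ae_of_all _ fun u => ?_)
  · have := continuous_fejer.measurable
    exact Measurable.aestronglyMeasurable (by fun_prop)
  · rw [norm_mul, Real.norm_of_nonneg (hB0 u), Real.norm_of_nonneg (fejer_nonneg _)]
    exact mul_le_mul_of_nonneg_right (hM u) (fejer_nonneg _)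

lemma setIntegral_window_fejer {l : ℝ} (hl : 0 < l) (η T : ℝ) (hη : 0 ≤ η) :
    ∫ u in Set.Icc (T - η) (T + η), fejer (l * (T - u)) =
      l⁻¹ * ∫ w in (-(l * η))..(l * η), fejer w := by
  rw [integral_Icc_eq_integral_Ioc, ← intervalIntegral.integral_of_le (by linarith)]
  have h := intervalIntegral.integral_comp_sub_left (f := fun x => fejer (l * x))
    (a := T - η) (b := T + η) T
  rw [h, intervalIntegral.integral_comp_mul_left _ hl.ne', smul_eq_mul]
  congr 2 <;> ring

lemma le_smoothed (hB : Measurable B) (hB0 : ∀ u, 0 ≤ B u) (hM : ∀ u, B u ≤ M)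
    (hmono : ∀ u v, 0 ≤ v → B u * Real.exp (-v) ≤ B (u + v))
    {l η T : ℝ} (hl : 0 < l) (hη : 0 < η) (hT : 0 < T) :
    Real.exp (-(2 * η)) * B T * (l⁻¹ * ∫ w in (-(l * η))..(l * η), fejer w) ≤
      ∫ u in Set.Ioi (0 : ℝ), B u * fejer (l * ((T + η) - u)) := by
  rw [← setIntegral_window_fejer hl η (T + η) hη.le, ← integral_const_mul]
  have hi := integrableOn_mul_fejer hB hB0 hM hl (T + η)
  calc _ ≤ ∫ u in Set.Icc (T + η - η) (T + η + η), B u * fejer (l * ((T + η) - u)) := by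
        refine setIntegral_mono_on ((integrable_fejer_comp hl _).const_mul _).integrableOn
          hi.integrableOn measurableSet_Icc fun u hu => ?_
        refine mul_le_mul_of_nonneg_right ?_ (fejer_nonneg _)
        have h := hmono T (u - T) (by linarith [hu.1])
        rw [add_sub_cancel] at h
        refine le_trans ?_ h
        rw [mul_comm]
        refine mul_le_mul_of_nonneg_left (Real.exp_le_exp.2 ?_) (hB0 _)
        linarith [hu.2]
    _ ≤ _ := by
        refine setIntegral_mono_set hi.integrableOn
          (ae_of_all _ fun u => mul_nonneg (hB0 u) (fejer_nonneg _)) ?_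
        refine Eventually.of_forall fun u hu => ?_
        exact lt_of_lt_of_le (by linarith) hu.1

lemma smoothed_le (hB : Measurable B) (hB0 : ∀ u, 0 ≤ B u) (hM : ∀ u, B u ≤ M)
    (hmono : ∀ u v, 0 ≤ v → B u * Real.exp (-v) ≤ B (u + v))
    {l η T : ℝ} (hl : 0 < l) (hη : 0 < η) :
    ∫ u in Set.Ioi (0 : ℝ), B u * fejer (l * ((T - η) - u)) ≤
      Real.exp (2 * η) * B T * (l⁻¹ * ∫ w in (-(l * η))..(l * η), fejer w) +
      M * (l⁻¹ * (∫ w, fejer w) - l⁻¹ * ∫ w in (-(l * η))..(l * η), fejer w) := by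
  have hi := integrableOn_mul_fejer hB hB0 hM hl (T - η)
  have hk := integrable_fejer_comp hl (T - η)
  set W := Set.Icc (T - η - η) (T - η + η) with hW
  have hfull : ∫ u, fejer (l * ((T - η) - u)) = l⁻¹ * ∫ w, fejer w := by
    rw [integral_sub_left_eq_self (fun x => fejer (l * x)) volume (T - η),
      Measure.integral_comp_mul_left, abs_of_pos (by positivity), smul_eq_mul]
  calc _ ≤ ∫ u, B u * fejer (l * ((T - η) - u)) :=
        setIntegral_le_integral hi (ae_of_all _ fun u => mul_nonneg (hB0 u) (fejer_nonneg _))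
    _ = (∫ u in W, B u * fejer (l * ((T - η) - u))) +
        ∫ u in Wᶜ, B u * fejer (l * ((T - η) - u)) :=
        (integral_add_compl measurableSet_Icc hi).symm
    _ ≤ (∫ u in W, Real.exp (2 * η) * B T * fejer (l * ((T - η) - u))) +
        ∫ u in Wᶜ, M * fejer (l * ((T - η) - u)) := by
        refine add_le_add ?_ ?_
        · refine setIntegral_mono_on hi.integrableOn (hk.const_mul _).integrableOn
            measurableSet_Icc fun u hu => ?_
          refine mul_le_mul_of_nonneg_right ?_ (fejer_nonneg _)
          have hu2 : u ≤ T := by linarith [hu.2]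
          have h := hmono u (T - u) (by linarith)
          rw [add_sub_cancel] at h
          have h3 : B u = Real.exp (T - u) * (B u * Real.exp (-(T - u))) := by
            rw [mul_comm (B u), ← mul_assoc, ← Real.exp_add]
            simp
          rw [h3]
          have h4 : T - u ≤ 2 * η := by linarith [hu.1]
          exact mul_le_mul (Real.exp_le_exp.2 h4) h
            (mul_nonneg (hB0 _) (Real.exp_nonneg _)) (Real.exp_nonneg _)
        · refine setIntegral_mono_on hi.integrableOn (hk.const_mul _).integrableOn
            measurableSet_Icc.compl fun u _ => ?_
          exact mul_le_mul_of_nonneg_right (hM u) (fejer_nonneg _)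
    _ = _ := by
        rw [integral_const_mul, integral_const_mul, ← setIntegral_window_fejer hl η (T - η) hη.le,
          ← hW, ← hfull, ← integral_add_compl (s := W) measurableSet_Icc hk]
        ring

/-- A Tauberian theorem of Wiener–Ikehara type. -/
theorem tendsto_of_laplace_transform_continuousOn (hB : Measurable B) (hB0 : ∀ u, 0 ≤ B u)
    (hM : ∀ u, B u ≤ M) (hmono : ∀ u v, 0 ≤ v → B u * Real.exp (-v) ≤ B (u + v))
    {G : ℂ → ℂ} (hGc : ContinuousOn G {z | 0 ≤ z.re})
    (hG : ∀ z : ℂ, 0 < z.re →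
      ∫ u in Set.Ioi (0 : ℝ), ((B u - A : ℝ) : ℂ) * Complex.exp (-u * z) = G z) :
    Tendsto B atTop (𝓝 A) := by
  set κ := ∫ w, fejer w with hκ
  have hκ0 : 0 < κ := integral_fejer_pos
  have hlim : ∀ l : ℝ, 0 < l → Tendsto (fun T : ℝ => ∫ u in Set.Ioi (0 : ℝ),
      B u * fejer (l * (T - u))) atTop (𝓝 (A * (l⁻¹ * κ))) := by
    intro l hl
    have h1 := tendsto_integral_mul_fejer (D := fun u => B u - A) (M := M + |A|)
      (hB.sub_const A) (fun u => (abs_sub _ _).trans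
        (add_le_add (by rw [abs_of_nonneg (hB0 u)]; exact hM u) le_rfl)) hGc hG hl
    have h2 := (tendsto_setIntegral_fejer hl).const_mul A
    have h3 := h1.add h2
    rw [zero_add, Measure.integral_comp_mul_left, abs_of_pos (by positivity), smul_eq_mul] at h3
    refine h3.congr fun T => ?_
    rw [← integral_const_mul, ← integral_add]
    · refine integral_congr_ae (ae_of_all _ fun u => ?_)
      simp only
      ring
    · simp_rw [sub_mul]
      exact ((integrableOn_mul_fejer hB hB0 hM hl T).sub
        ((integrable_fejer_comp hl T).const_mul A)).integrableOn
    · exact ((integrable_fejer_comp hl T).const_mul A).integrableOn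
  set k : ℝ → ℝ := fun N => ∫ w in (-N)..N, fejer w with hk
  have hklim : Tendsto k atTop (𝓝 κ) :=
    intervalIntegral_tendsto_integral integrable_fejer tendsto_neg_atTop_atBot tendsto_id
  have hinv : Tendsto (fun N : ℝ => N⁻¹) atTop (𝓝 0) := tendsto_inv_atTop_zero
  have hexp : Tendsto (fun N : ℝ => Real.exp (2 * N⁻¹)) atTop (𝓝 1) := by
    have := (Real.continuous_exp.tendsto _).comp (hinv.const_mul 2)
    simpa [Function.comp_def] using this
  -- for each `N`, two-sided bounds on `B`
  have hup : ∀ N : ℝ, 0 < N → ∀ᶠ T in atTop,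
      B T * k N ≤ Real.exp (2 * N⁻¹) * (A * κ + N⁻¹) := by
    intro N hN
    have hl : 0 < N ^ 2 := by positivity
    have h := (hlim _ hl).comp (tendsto_atTop_add_const_right atTop N⁻¹ tendsto_id)
    have h2 := h.eventually_le_const (u := (N ^ 2)⁻¹ * (A * κ + N⁻¹)) (by
      have : 0 < (N ^ 2)⁻¹ * N⁻¹ := by positivity
      linarith)
    filter_upwards [h2, eventually_gt_atTop 0] with T hT hT0
    have h3 := (le_smoothed hB hB0 hM hmono hl (inv_pos.2 hN) hT0).trans hT
    rw [show N ^ 2 * N⁻¹ = N by field_simp] at h3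
    have h4 : Real.exp (-(2 * N⁻¹)) * B T * k N ≤ A * κ + N⁻¹ := by
      have := mul_le_mul_of_nonneg_left h3 hl.le
      rw [mul_inv_cancel_left₀ hl.ne'] at this
      refine le_trans (le_of_eq ?_) this
      simp only [hk]
      field_simp
    have h5 := mul_le_mul_of_nonneg_left h4 (Real.exp_nonneg (2 * N⁻¹))
    rwa [mul_assoc (Real.exp _), ← mul_assoc (Real.exp (2 * N⁻¹)), ← Real.exp_add, add_neg_cancel,
      Real.exp_zero, one_mul] at h5
  have hlow : ∀ N : ℝ, 0 < N → ∀ᶠ T in atTop,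
      A * κ - N⁻¹ - M * (κ - k N) ≤ Real.exp (2 * N⁻¹) * (B T * k N) := by
    intro N hN
    have hl : 0 < N ^ 2 := by positivity
    have h := (hlim _ hl).comp (tendsto_atTop_add_const_right atTop (-N⁻¹) tendsto_id)
    have h2 := h.eventually_const_le (u := (N ^ 2)⁻¹ * (A * κ - N⁻¹)) (by
      have : 0 < (N ^ 2)⁻¹ * N⁻¹ := by positivity
      linarith)
    filter_upwards [h2] with T hT
    have h3 := le_trans hT (smoothed_le (T := T) hB hB0 hM hmono hl (inv_pos.2 hN))
    rw [show N ^ 2 * N⁻¹ = N by field_simp] at h3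
    have := mul_le_mul_of_nonneg_left h3 hl.le
    rw [mul_inv_cancel_left₀ hl.ne'] at this
    have h6 : N ^ 2 * (Real.exp (2 * N⁻¹) * B T * ((N ^ 2)⁻¹ * k N) +
        M * ((N ^ 2)⁻¹ * κ - (N ^ 2)⁻¹ * k N)) =
        Real.exp (2 * N⁻¹) * (B T * k N) + M * (κ - k N) := by
      field_simp
    simp only [hk] at h6 ⊢
    rw [h6] at this
    linarith
  have hkpos : ∀ᶠ N in atTop, 0 < k N := hklim.eventually_const_lt hκ0
  refine tendsto_order.2 ⟨fun c hc => ?_, fun c hc => ?_⟩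
  · have hl : Tendsto (fun N => (A * κ - N⁻¹ - M * (κ - k N)) / (Real.exp (2 * N⁻¹) * k N)) atTop
        (𝓝 ((A * κ - 0 - M * (κ - κ)) / (1 * κ))) :=
      ((hinv.const_sub _).sub ((hklim.const_sub _).const_mul _)).div (hexp.mul hklim)
        (by simpa using hκ0.ne')
    have he : (A * κ - 0 - M * (κ - κ)) / (1 * κ) = A := by field_simp; ring
    rw [he] at hl
    obtain ⟨N, hN, hN1, hN2⟩ := ((hl.eventually_const_lt hc).and
      (hkpos.and (eventually_gt_atTop 0))).exists
    filter_upwards [hlow N hN2] with T hT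
    refine hN.trans_le ?_
    rw [div_le_iff₀ (by positivity)]
    linarith
  · have hl : Tendsto (fun N => Real.exp (2 * N⁻¹) * (A * κ + N⁻¹) / k N) atTop
        (𝓝 (1 * (A * κ + 0) / κ)) :=
      (hexp.mul (hinv.const_add _)).div hklim hκ0.ne'
    have he : 1 * (A * κ + 0) / κ = A := by field_simp; ring
    rw [he] at hl
    obtain ⟨N, hN, hN1, hN2⟩ := ((hl.eventually_lt_const hc).and
      (hkpos.and (eventually_gt_atTop 0))).exists
    filter_upwards [hup N hN2] with T hT
    refine lt_of_le_of_lt ?_ hN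
    rw [le_div_iff₀ hN1]
    exact hT

end Desmoothing

section PrimesInProgressions
open MeasureTheory Topology ArithmeticFunction.vonMangoldt

/-- The Chebyshev function `ψ(x; q, a)`. -/
noncomputable def psiAP {q : ℕ} (a : ZMod q) (x : ℝ) : ℝ := ∑ k ∈ Icc 1 ⌊x⌋₊, residueClass a k

/-- The Chebyshev function `θ(x; q, a)`. -/
noncomputable def thetaAP {q : ℕ} (a : ZMod q) (x : ℝ) : ℝ :=
  ∑ p ∈ (Icc 1 ⌊x⌋₊).filter (fun p : ℕ => p.Prime ∧ (p : ZMod q) = a), Real.log p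

variable {q : ℕ} (a : ZMod q)

lemma psiAP_nonneg (x : ℝ) : 0 ≤ psiAP a x := sum_nonneg fun _ _ => residueClass_nonneg a _

lemma psiAP_mono : Monotone (psiAP a) := fun _ _ h =>
  sum_le_sum_of_subset_of_nonneg (Icc_subset_Icc le_rfl (Nat.floor_mono h))
    fun _ _ _ => residueClass_nonneg a _

lemma psiAP_le {x : ℝ} (hx : 0 ≤ x) : psiAP a x ≤ (Real.log 4 + 4) * x := by
  refine le_trans ?_ (Chebyshev.psi_le_const_mul_self hx)
  unfold Chebyshev.psi psiAP
  exact sum_le_sum fun k _ => residueClass_le a k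

lemma LSeries_residueClass_eq_integral {z : ℂ} (hz : 0 < z.re) :
    LSeries (fun n => (residueClass a n : ℂ)) (1 + z) = (1 + z) *
      ∫ u in Set.Ioi (0 : ℝ), ((Real.exp (-u) * psiAP a (Real.exp u) : ℝ) : ℂ) *
        Complex.exp (-u * z) := by
  rw [LSeries_eq_mul_integral_of_nonneg (residueClass a) (r := 1) zero_le_one
    (by simpa using hz) ?_ (residueClass_nonneg a)]
  · congr 1
    have himg : Real.exp '' Set.Ioi 0 = Set.Ioi 1 := by rw [Real.image_exp_Ioi, Real.exp_zero]
    rw [← himg, integral_image_eq_integral_abs_deriv_smul measurableSet_Ioi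
      (fun x _ => (Real.hasDerivAt_exp x).hasDerivWithinAt) Real.exp_injective.injOn]
    refine integral_congr_ae (ae_of_all _ fun u => ?_)
    simp only
    rw [Real.abs_exp, Complex.real_smul, psiAP]
    have : ((Real.exp u : ℝ) : ℂ) ^ (-(1 + z + 1)) = Complex.exp (u * (-(1 + z + 1))) := by
      rw [Complex.cpow_def_of_ne_zero (by simp), ← Complex.ofReal_log (Real.exp_nonneg _),
        Real.log_exp]
    rw [this]
    push_cast
    have h2 : Complex.exp u * Complex.exp (u * (-(1 + z + 1))) =
        Complex.exp (-u) * Complex.exp (-u * z) := by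
      rw [← Complex.exp_add, ← Complex.exp_add]
      congr 1
      ring
    linear_combination (∑ k ∈ Icc 1 ⌊Real.exp u⌋₊, (residueClass a k : ℂ)) * h2
  · refine Asymptotics.IsBigO.of_bound (Real.log 4 + 4) (Eventually.of_forall fun n => ?_)
    have := psiAP_le a (x := n) n.cast_nonneg
    rw [psiAP, Nat.floor_natCast] at this
    rw [Real.norm_of_nonneg (sum_nonneg fun _ _ => residueClass_nonneg a _), Real.rpow_one,
      Real.norm_of_nonneg n.cast_nonneg]
    exact this

theorem tendsto_psiAP_div [NeZero q] (ha : IsUnit a) :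
    Tendsto (fun x => psiAP a x / x) atTop (𝓝 (q.totient : ℝ)⁻¹) := by
  set B : ℝ → ℝ := fun u => Real.exp (-u) * psiAP a (Real.exp u) with hBdef
  set A : ℝ := (q.totient : ℝ)⁻¹ with hA
  have hB : Measurable B :=
    (by fun_prop : Measurable fun u : ℝ => Real.exp (-u)).mul
      ((psiAP_mono a).measurable.comp Real.measurable_exp)
  have hB0 : ∀ u, 0 ≤ B u := fun u => mul_nonneg (Real.exp_nonneg _) (psiAP_nonneg a _)
  have hM : ∀ u, B u ≤ Real.log 4 + 4 := by
    intro u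
    calc B u ≤ Real.exp (-u) * ((Real.log 4 + 4) * Real.exp u) :=
          mul_le_mul_of_nonneg_left (psiAP_le a (Real.exp_nonneg _)) (Real.exp_nonneg _)
      _ = Real.log 4 + 4 := by
          rw [mul_left_comm, ← Real.exp_add]; simp
  have hmono : ∀ u v, 0 ≤ v → B u * Real.exp (-v) ≤ B (u + v) := by
    intro u v hv
    have h := psiAP_mono a (Real.exp_le_exp.2 (by linarith : u ≤ u + v))
    calc B u * Real.exp (-v) = Real.exp (-(u + v)) * psiAP a (Real.exp u) := by
          rw [neg_add, Real.exp_add]; simp only [hBdef]; ring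
      _ ≤ _ := mul_le_mul_of_nonneg_left h (Real.exp_nonneg _)
  set G : ℂ → ℂ := fun z => (LFunctionResidueClassAux a (1 + z) - A) / (1 + z) with hGdef
  have hGc : ContinuousOn G {z | 0 ≤ z.re} := by
    refine ContinuousOn.div (ContinuousOn.sub ?_ continuousOn_const) (by fun_prop) ?_
    · refine (continuousOn_LFunctionResidueClassAux a).comp (by fun_prop) fun z hz => ?_
      simpa using hz
    · intro z hz h
      have := congrArg Complex.re h
      simp at this
      have hz' : 0 ≤ z.re := hz
      linarith
  have hG : ∀ z : ℂ, 0 < z.re →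
      ∫ u in Set.Ioi (0 : ℝ), ((B u - A : ℝ) : ℂ) * Complex.exp (-u * z) = G z := by
    intro z hz
    have h1z : (1 + z) ≠ 0 := by
      intro h
      have := congrArg Complex.re h
      simp at this
      linarith
    have hz0 : z ≠ 0 := by rintro rfl; simp at hz
    have hexp : IntegrableOn (fun u : ℝ => Complex.exp (-u * z)) (Set.Ioi 0) := by
      have := integrableOn_exp_mul_complex_Ioi (a := -z) (by simpa using hz) 0
      refine this.congr_fun (fun u _ => ?_) measurableSet_Ioi
      simp only
      congr 1
      ring
    have hexpi : ∫ u in Set.Ioi (0 : ℝ), Complex.exp (-u * z) = 1 / z := by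
      have := integral_exp_mul_complex_Ioi (a := -z) (by simpa using hz) 0
      simp at this
      rw [one_div, ← this]
      refine integral_congr_ae (ae_of_all _ fun u => ?_)
      simp only
      congr 1
      ring
    have hBi : IntegrableOn (fun u : ℝ => (B u : ℂ) * Complex.exp (-u * z)) (Set.Ioi 0) := by
      refine Integrable.bdd_mul (c := Real.log 4 + 4) hexp ?_ (ae_of_all _ fun u => ?_)
      · exact (Complex.measurable_ofReal.comp hB).aestronglyMeasurable
      · rw [Complex.norm_real, Real.norm_of_nonneg (hB0 u)]
        exact hM u
    have hs : ∫ u in Set.Ioi (0 : ℝ), ((B u - A : ℝ) : ℂ) * Complex.exp (-u * z) =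
        (∫ u in Set.Ioi (0 : ℝ), (B u : ℂ) * Complex.exp (-u * z)) - A * (1 / z) := by
      rw [← hexpi, ← integral_const_mul, ← integral_sub hBi (hexp.const_mul _)]
      refine integral_congr_ae (ae_of_all _ fun u => ?_)
      simp only
      push_cast
      ring
    have hL := LSeries_residueClass_eq_integral a hz
    have hE := eqOn_LFunctionResidueClassAux ha (show 1 + z ∈ {s : ℂ | 1 < s.re} by simpa using hz)
    simp only at hE
    rw [hs, hGdef]
    beta_reduce
    rw [hE, hL]
    have hAc : ((A : ℝ) : ℂ) = (q.totient : ℂ)⁻¹ := by rw [hA]; push_cast; rfl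
    rw [hAc]
    simp only [hBdef]
    rw [add_sub_cancel_left]
    generalize (∫ u in Set.Ioi (0 : ℝ), ((Real.exp (-u) * psiAP a (Real.exp u) : ℝ) : ℂ) *
      Complex.exp (-u * z)) = J
    generalize (q.totient : ℂ)⁻¹ = c
    field_simp
    ring
  have h := tendsto_of_laplace_transform_continuousOn hB hB0 hM hmono hGc hG
  refine (h.comp Real.tendsto_log_atTop).congr' ?_
  filter_upwards [eventually_gt_atTop 0] with x hx
  simp only [Function.comp, hBdef]
  rw [Real.exp_neg, Real.exp_log hx]
  ring

lemma abs_psiAP_sub_thetaAP_le {x : ℝ} (hx : 1 ≤ x) :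
    |psiAP a x - thetaAP a x| ≤ 2 * √x * Real.log x := by
  have hs : psiAP a x - thetaAP a x =
      ∑ k ∈ (Icc 1 ⌊x⌋₊).filter (fun k => ¬ k.Prime), residueClass a k := by
    rw [psiAP, thetaAP, ← sum_filter_add_sum_filter_not (Icc 1 ⌊x⌋₊) Nat.Prime, ← filter_filter,
      sum_filter (fun p : ℕ => (p : ZMod q) = a)]
    rw [add_sub_right_comm, ← sum_sub_distrib, sum_eq_zero, zero_add]
    intro p hp
    have hp' := (mem_filter.1 hp).2
    simp only [residueClass, Set.indicator, Set.mem_ofPred_eq]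
    split_ifs <;> simp [ArithmeticFunction.vonMangoldt_apply_prime hp']
  rw [hs, abs_of_nonneg (sum_nonneg fun _ _ => residueClass_nonneg a _)]
  refine le_trans ?_ (Chebyshev.psi_sub_theta_le hx)
  rw [Chebyshev.psi_sub_theta_eq_sum_not_prime]
  exact sum_le_sum fun k _ => residueClass_le a k

/-- The prime number theorem in arithmetic progressions. -/
theorem tendsto_thetaAP_div [NeZero q] (ha : IsUnit a) :
    Tendsto (fun x => thetaAP a x / x) atTop (𝓝 (q.totient : ℝ)⁻¹) := by
  have h0 : Tendsto (fun x : ℝ => 2 * (Real.log x / x ^ (1 / 2 : ℝ))) atTop (𝓝 0) := by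
    have := (isLittleO_log_rpow_atTop (r := 1 / 2) (by norm_num)).tendsto_div_nhds_zero
    simpa using this.const_mul 2
  have h1 : Tendsto (fun x => psiAP a x / x - thetaAP a x / x) atTop (𝓝 0) := by
    refine squeeze_zero_norm' ?_ h0
    filter_upwards [eventually_ge_atTop 1] with x hx
    have hx0 : 0 < x := by linarith
    rw [← sub_div, norm_div, Real.norm_of_nonneg hx0.le, Real.norm_eq_abs,
      div_le_iff₀ hx0, ← Real.sqrt_eq_rpow]
    refine (abs_psiAP_sub_thetaAP_le a hx).trans (le_of_eq ?_)
    have := Real.sq_sqrt hx0.le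
    have h3 : 0 < √x := Real.sqrt_pos.2 hx0
    field_simp
    rw [this, mul_comm]
  have := (tendsto_psiAP_div a ha).sub h1
  simpa using this

end PrimesInProgressions

section Denominators

lemma vab_eq_den (r : ℕ → ℤ) {a b : ℕ} (ha : 1 ≤ a) :
    vab r a b = (∑ i ∈ Icc a b, (r i : ℚ) / i).den := by
  have hL : Lab r a b ≠ 0 := by
    rw [Lab, Ne, Finset.lcm_eq_zero_iff]
    rintro ⟨i, hi, h0⟩
    have := (mem_Icc.1 (mem_filter.1 hi).1).1
    simp only [id] at h0
    omega
  have hsum : ∑ i ∈ Icc a b, (r i : ℚ) / i = ((Xab r a b : ℤ) : ℚ) / ((Lab r a b : ℤ) : ℚ) := by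
    rw [eq_div_iff (by exact_mod_cast hL), Xab, sum_mul]
    simp only [Int.cast_sum, Int.cast_mul, Int.cast_natCast]
    refine sum_congr rfl fun i hi => ?_
    by_cases h0 : r i = 0
    · simp [h0]
    have hi0 : i ≠ 0 := by have := (mem_Icc.1 hi).1; omega
    have hd : i ∣ Lab r a b := dvd_lcm (f := id) (mem_filter.2 ⟨hi, h0⟩)
    rw [Nat.cast_div hd (by exact_mod_cast hi0)]
    ring
  rw [hsum, ← Rat.divInt_eq_div, Rat.den_divInt, if_neg (by exact_mod_cast hL), vab, gab,
    Int.gcd_comm, Int.natAbs_natCast]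

lemma not_dvd_den_add {q : ℕ} (hq : q.Prime) {x y : ℚ} (hx : ¬ q ∣ x.den) (hy : ¬ q ∣ y.den) :
    ¬ q ∣ (x + y).den := fun h =>
  (hq.dvd_mul.1 (h.trans (Rat.add_den_dvd x y))).elim hx hy

lemma not_dvd_den_sum {q : ℕ} (hq : q.Prime) {ι : Type*} (s : Finset ι) (f : ι → ℚ)
    (h : ∀ i ∈ s, ¬ q ∣ (f i).den) : ¬ q ∣ (∑ i ∈ s, f i).den := by
  classical
  induction s using Finset.induction_on with
  | empty => simpa using hq.one_lt.ne'
  | insert a s ha ih =>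
    rw [sum_insert ha]
    exact not_dvd_den_add hq (h a (mem_insert_self a s))
      (ih fun i hi => h i (mem_insert_of_mem hi))

lemma not_dvd_den_div {q : ℕ} (N D : ℤ) (hD : ¬ (q : ℤ) ∣ D) :
    ¬ q ∣ ((N : ℚ) / D).den := by
  intro h
  rw [← Rat.divInt_eq_div] at h
  exact hD ((Int.natCast_dvd_natCast.2 h).trans (Rat.den_dvd N D))

lemma dvd_den_div {q : ℕ} (hq : q.Prime) {N D : ℤ} (hD0 : D ≠ 0) (hD : (q : ℤ) ∣ D)
    (hN : ¬ (q : ℤ) ∣ N) : q ∣ ((N : ℚ) / D).den := by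
  set x : ℚ := (N : ℚ) / D with hx
  have h : x.num * D = N * x.den := by
    have h1 : (x.num : ℚ) / x.den = N / D := by rw [Rat.num_div_den]
    rw [div_eq_div_iff (by exact_mod_cast x.den_nz) (by exact_mod_cast hD0)] at h1
    exact_mod_cast h1
  have hp : Prime (q : ℤ) := Nat.prime_iff_prime_int.1 hq
  have h2 : (q : ℤ) ∣ N * x.den := h ▸ Dvd.dvd.mul_left hD _
  exact Int.natCast_dvd_natCast.1 ((hp.dvd_or_dvd h2).resolve_left hN)

lemma dvd_den_sum_of_unique {q : ℕ} (hq : q.Prime) (r : ℕ → ℤ) {s : Finset ℕ} {i₀ : ℕ}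
    (hi : i₀ ∈ s) (h0 : i₀ ≠ 0) (hd : q ∣ i₀) (hr : ¬ (q : ℤ) ∣ r i₀)
    (huniq : ∀ i ∈ s, q ∣ i → i ≠ i₀ → r i = 0) :
    q ∣ (∑ i ∈ s, (r i : ℚ) / i).den := by
  by_contra h
  have hrest : ¬ q ∣ (-∑ i ∈ s.erase i₀, (r i : ℚ) / i).den := by
    rw [Rat.neg_den]
    refine not_dvd_den_sum hq _ _ fun i hi' => ?_
    obtain ⟨hne, his⟩ := mem_erase.1 hi'
    by_cases hqi : q ∣ i
    · simpa [huniq i his hqi hne] using hq.one_lt.ne'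
    · exact_mod_cast not_dvd_den_div (r i) (i : ℤ) (by exact_mod_cast hqi)
  have := not_dvd_den_add hq h hrest
  rw [← add_sum_erase s _ hi, add_neg_cancel_right] at this
  refine this ?_
  exact_mod_cast dvd_den_div hq (N := r i₀) (D := (i₀ : ℤ)) (by exact_mod_cast h0)
    (by exact_mod_cast hd) hr

/-- If the denominator of `x` absorbs `b` up to a factor `m < p`, and adding `z / b` removes the
prime `p` from the denominator, then the denominator drops. -/
lemma den_add_lt {p m Q b : ℕ} (hp : p.Prime) (hm : m < p) (hb : b = p * m * Q) (hb0 : b ≠ 0)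
    (hpQ : p.Coprime Q) {x : ℚ} {z : ℤ} (hz : ¬ (p : ℤ) ∣ z) (hQ : Q ∣ x.den)
    (hpx : ¬ p ∣ (x + (z : ℚ) / b).den) : (x + (z : ℚ) / b).den < x.den := by
  have hy : p ∣ ((z : ℚ) / b).den := by
    exact_mod_cast dvd_den_div hp (N := z) (D := (b : ℤ)) (by exact_mod_cast hb0)
      (by rw [hb]; push_cast; exact ⟨m * Q, by ring⟩) hz
  have hpden : p ∣ x.den := by
    by_contra h
    have := not_dvd_den_add hp hpx (y := -x) (by rwa [Rat.neg_den])
    rw [add_comm, neg_add_cancel_left] at this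
    exact this hy
  obtain ⟨w, hw⟩ := hpQ.mul_dvd_of_dvd_of_dvd hpden hQ
  have hm0 : 0 < m := by
    rcases Nat.eq_zero_or_pos m with rfl | h
    · simp [hb] at hb0
    · exact h
  have hyb : ((z : ℚ) / b).den ∣ x.den * m := by
    have h1 : ((z : ℚ) / b).den ∣ b := by
      have := Rat.den_dvd z (b : ℤ)
      rw [Rat.divInt_eq_div] at this
      exact_mod_cast this
    refine h1.trans ⟨w, ?_⟩
    rw [hb, hw]
    ring
  have hdvd : (x + (z : ℚ) / b).den ∣ p * (Q * w * m) := by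
    refine (Rat.add_den_dvd_lcm _ _).trans ?_
    have := Nat.lcm_dvd (Dvd.intro m rfl : x.den ∣ x.den * m) hyb
    exact this.trans (dvd_of_eq (by rw [hw]; ring))
  have hcop : Nat.Coprime (x + (z : ℚ) / b).den p := ((hp.coprime_iff_not_dvd).2 hpx).symm
  have hd2 := hcop.dvd_of_dvd_mul_left hdvd
  have hQw : 0 < Q * w := by
    refine Nat.pos_of_ne_zero fun h => x.den_nz ?_
    rw [hw, mul_assoc, h, mul_zero]
  calc _ ≤ Q * w * m := Nat.le_of_dvd (by positivity) hd2
    _ < Q * w * p := by gcongr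
    _ = x.den := by rw [hw]; ring

lemma bfun_le {r : ℕ → ℤ} {a b : ℕ} (ha : 1 ≤ a) (hab : a < b)
    (h : (∑ i ∈ Icc a b, (r i : ℚ) / i).den < (∑ i ∈ Icc a (b - 1), (r i : ℚ) / i).den) :
    bfun r a ≤ b :=
  Nat.sInf_le ⟨hab, by rwa [vab_eq_den r ha, vab_eq_den r ha]⟩

end Denominators

section Incidence

variable {F : Type*} [Field F] [Fintype F] [DecidableEq F]

lemma card_common_point_le_one {l l' : F × F} (h : l ≠ l') :
    #{x : F | l.1 * x + l.2 = l'.1 * x + l'.2} ≤ 1 := by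
  rw [card_le_one]
  intro x hx y hy
  simp only [mem_filter, mem_univ, true_and] at hx hy
  by_contra hxy
  have h1 : (l.1 - l'.1) * (x - y) = 0 := by linear_combination hx - hy
  have h2 : l.1 = l'.1 :=
    sub_eq_zero.1 ((mul_eq_zero.1 h1).resolve_right (sub_ne_zero.2 hxy))
  refine h (Prod.ext h2 ?_)
  rw [h2] at hx
  exact add_left_cancel hx

/-- Points and lines in the affine plane over a finite field without incidences are few. -/
lemma card_mul_card_le_of_no_incidence (P L : Finset (F × F))
    (h : ∀ z ∈ P, ∀ l ∈ L, l.1 * z.1 + l.2 ≠ z.2) : #P * #L ≤ Fintype.card F ^ 3 := by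
  set p : ℤ := (Fintype.card F : ℤ) with hp
  have hp0 : 0 < p := by rw [hp]; exact_mod_cast Fintype.card_pos
  set N : F → F → ℤ := fun x y => ∑ l ∈ L, if l.1 * x + l.2 = y then 1 else 0 with hN
  have h1 : ∑ x, ∑ y, N x y = p * #L := by
    have : ∀ x, ∑ y, N x y = #L := by
      intro x
      simp only [hN]
      rw [sum_comm]
      simp
    simp [this, hp]
  have h2 : ∑ x, ∑ y, N x y ^ 2 ≤ (#L : ℤ) ^ 2 + p * #L := by
    have e : ∀ x, ∑ y, N x y ^ 2 =
        ∑ l ∈ L, ∑ l' ∈ L, if l.1 * x + l.2 = l'.1 * x + l'.2 then (1 : ℤ) else 0 := by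
      intro x
      simp only [hN, sq, sum_mul_sum]
      rw [sum_comm]
      refine sum_congr rfl fun l _ => ?_
      rw [sum_comm]
      refine sum_congr rfl fun l' _ => ?_
      simp [eq_comm]
    simp_rw [e]
    rw [sum_comm]
    have e2 : ∀ l ∈ L, ∑ x, ∑ l' ∈ L,
        (if l.1 * x + l.2 = l'.1 * x + l'.2 then (1 : ℤ) else 0) ≤ #L + p := by
      intro l hl
      rw [sum_comm]
      have e3 : ∀ l' ∈ L, ∑ x, (if l.1 * x + l.2 = l'.1 * x + l'.2 then (1 : ℤ) else 0) ≤
          1 + if l = l' then p else 0 := by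
        intro l' _
        rw [sum_boole]
        split_ifs with hll
        · subst hll
          simp [hp]
        · simpa using card_common_point_le_one hll
      refine (sum_le_sum e3).trans ?_
      rw [sum_add_distrib, sum_ite_eq, if_pos hl]
      simp
    refine (sum_le_sum e2).trans ?_
    simp
    ring_nf
    rfl
  have h3 : ∑ x, ∑ y, (p * N x y - #L) ^ 2 ≤ p ^ 3 * #L := by
    have : ∑ x, ∑ y, (p * N x y - #L) ^ 2 = p ^ 2 * (∑ x, ∑ y, N x y ^ 2) -
        2 * p * #L * (∑ x, ∑ y, N x y) + p ^ 2 * (#L : ℤ) ^ 2 := by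
      have e : ∀ x y, (p * N x y - #L) ^ 2 =
          p ^ 2 * N x y ^ 2 - 2 * p * #L * N x y + (#L : ℤ) ^ 2 := fun x y => by ring
      simp_rw [e, sum_add_distrib, sum_sub_distrib, ← mul_sum]
      simp [hp]
      ring
    rw [this, h1]
    nlinarith [mul_le_mul_of_nonneg_left h2 (sq_nonneg p)]
  have h4 : (#P : ℤ) * (#L : ℤ) ^ 2 ≤ ∑ x, ∑ y, (p * N x y - #L) ^ 2 := by
    rw [← Fintype.sum_prod_type' (f := fun x y => (p * N x y - #L) ^ 2)]
    calc (#P : ℤ) * (#L : ℤ) ^ 2 = ∑ z ∈ P, (p * N z.1 z.2 - #L) ^ 2 := by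
          have : ∀ z ∈ P, (p * N z.1 z.2 - #L) ^ 2 = (#L : ℤ) ^ 2 := by
            intro z hz
            have : N z.1 z.2 = 0 := sum_eq_zero fun l hl => if_neg (h z hz l hl)
            rw [this]
            ring
          rw [sum_congr rfl this]
          simp
      _ ≤ _ := sum_le_sum_of_subset_of_nonneg (subset_univ P) fun _ _ _ => sq_nonneg _
  have h5 := h4.trans h3
  rcases Nat.eq_zero_or_pos #L with h0 | h0
  · simp [h0]
  · have h0' : (0 : ℤ) < #L := by exact_mod_cast h0
    have : (#P : ℤ) * #L ≤ p ^ 3 := by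
      refine le_of_mul_le_mul_right ?_ h0'
      linarith [h5]
    rw [hp] at this
    exact_mod_cast this

/-- If the sets are large then `u = c * a * a' + v` is soluble. -/
lemma exists_mul_mul_add_eq (A A' U V : Finset F) {c : F} (hc : c ≠ 0)
    (h : Fintype.card F ^ 3 < #A * #A' * (#U * #V)) :
    ∃ a ∈ A, ∃ a' ∈ A', ∃ u ∈ U, ∃ v ∈ V, c * a * a' + v = u := by
  by_contra! hno
  have := card_mul_card_le_of_no_incidence (A' ×ˢ U) (A.image (c * ·) ×ˢ V) (by
    rintro ⟨a', u⟩ hz ⟨l, v⟩ hl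
    obtain ⟨hl1, hv⟩ := mem_product.1 hl
    obtain ⟨a, ha, rfl⟩ := mem_image.1 hl1
    obtain ⟨ha', hu⟩ := mem_product.1 hz
    exact hno a ha a' ha' u hu v hv)
  rw [card_product, card_product, card_image_of_injective _ (mul_right_injective₀ hc)] at this
  have e : #A' * #U * (#A * #V) = #A * #A' * (#U * #V) := by ring
  omega

end Incidence

section SmallMultiplier

lemma exists_small_multiplier {p t : ℕ} [Fact p.Prime] (ht : 1 ≤ t) (hpt : 4 * t ≤ p)
    (c : ZMod t) {A A' : Finset ℕ}
    (hA : Set.InjOn (fun a : ℕ => (a : ZMod p)) A)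
    (hA' : Set.InjOn (fun a : ℕ => (a : ZMod p)) A') {w : ZMod p} (hw : w ≠ 0)
    (h : 16 * t ^ 2 * p < #A * #A') :
    ∃ a ∈ A, ∃ a' ∈ A', ∃ m : ℕ, 1 ≤ m ∧ m < p ∧ (m : ZMod t) = c ∧
      (m : ZMod p) = w * a * a' := by
  have hp : p.Prime := Fact.out
  have : NeZero t := ⟨by omega⟩
  have hct : ((c.val : ℕ) : ZMod t) = c := ZMod.natCast_zmod_val c
  have hclt : c.val < t := c.val_lt
  obtain ⟨Y, hY⟩ : ∃ Y, Y = (p - 1) / (2 * t) := ⟨_, rfl⟩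
  have hY1 : 2 * t * Y < p := by
    have := Nat.mul_div_le (p - 1) (2 * t)
    rw [← hY] at this
    have := hp.pos
    omega
  have hY2 : p ≤ 4 * t * Y := by
    have h1 := Nat.lt_mul_div_succ (p - 1) (show 0 < 2 * t by omega)
    rw [← hY] at h1
    have h2 : p ≤ 2 * t * Y + 2 * t := by
      have : 2 * t * (Y + 1) = 2 * t * Y + 2 * t := by ring
      omega
    have : 4 * t * Y = 2 * (2 * t * Y) := by ring
    omega
  have hYp : Y < p := by
    have : Y ≤ 2 * t * Y := Nat.le_mul_of_pos_left _ (by omega)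
    omega
  have hY0 : 0 < Y := by
    rcases Nat.eq_zero_or_pos Y with h0 | h0
    · rw [h0] at hY2; have := hp.pos; omega
    · exact h0
  have htp : (t : ZMod p) ≠ 0 := by
    rw [Ne, ZMod.natCast_eq_zero_iff]
    intro hd
    have := Nat.le_of_dvd (by omega) hd
    omega
  have hinj : ∀ x y : ℕ, x < Y → y < Y → (x : ZMod p) = y → x = y := by
    intro x y hx hy hxy
    have := (ZMod.natCast_eq_natCast_iff' x y p).1 hxy
    rwa [Nat.mod_eq_of_lt (hx.trans hYp), Nat.mod_eq_of_lt (hy.trans hYp)] at this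
  set U : Finset (ZMod p) := (range Y).image fun x => ((t * (Y + x + 1) + c.val : ℕ) : ZMod p)
  set V : Finset (ZMod p) := (range Y).image fun x => ((t * (x + 1) : ℕ) : ZMod p)
  have hU : #U = Y := by
    rw [card_image_of_injOn, card_range]
    intro x hx y hy hxy
    simp only [coe_range, Set.mem_Iio] at hx hy
    refine hinj x y hx hy ?_
    push_cast at hxy
    have h1 : (t : ZMod p) * ((x : ZMod p) - y) = 0 := by linear_combination hxy
    exact sub_eq_zero.1 ((mul_eq_zero.1 h1).resolve_left htp)
  have hV : #V = Y := by
    rw [card_image_of_injOn, card_range]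
    intro x hx y hy hxy
    simp only [coe_range, Set.mem_Iio] at hx hy
    refine hinj x y hx hy ?_
    push_cast at hxy
    have h1 : (t : ZMod p) * ((x : ZMod p) - y) = 0 := by linear_combination hxy
    exact sub_eq_zero.1 ((mul_eq_zero.1 h1).resolve_left htp)
  obtain ⟨α, hα, α', hα', u, hu, v, hv, he⟩ := exists_mul_mul_add_eq
    (A.image fun a : ℕ => (a : ZMod p)) (A'.image fun a : ℕ => (a : ZMod p)) U V hw (by
      rw [card_image_of_injOn hA, card_image_of_injOn hA', hU, hV, ZMod.card]
      have h1 : p * p ≤ 4 * t * Y * (4 * t * Y) := Nat.mul_le_mul hY2 hY2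
      calc p ^ 3 = p * p * p := by ring
        _ ≤ 4 * t * Y * (4 * t * Y) * p := Nat.mul_le_mul_right _ h1
        _ = 16 * t ^ 2 * p * (Y * Y) := by ring
        _ < _ := Nat.mul_lt_mul_of_pos_right h (by positivity))
  obtain ⟨a, ha, rfl⟩ := mem_image.1 hα
  obtain ⟨a', ha', rfl⟩ := mem_image.1 hα'
  obtain ⟨x, hx, rfl⟩ := mem_image.1 hu
  obtain ⟨y, hy, rfl⟩ := mem_image.1 hv
  rw [mem_range] at hx hy
  refine ⟨a, ha, a', ha', t * (Y + x - y) + c.val, ?_, ?_, ?_, ?_⟩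
  · have : 1 * 1 ≤ t * (Y + x - y) := Nat.mul_le_mul ht (by omega)
    omega
  · have h1 : t * (Y + x - y) ≤ t * (2 * Y - 1) := Nat.mul_le_mul le_rfl (by omega)
    have h2 : t * (2 * Y - 1) + t = 2 * t * Y := by
      obtain ⟨Z, rfl⟩ : ∃ Z, Y = Z + 1 := ⟨Y - 1, by omega⟩
      rw [show 2 * (Z + 1) - 1 = 2 * Z + 1 by omega]
      ring
    omega
  · push_cast
    simp [hct]
  · push_cast [Nat.cast_sub (show y ≤ Y + x by omega)]
    push_cast at he
    linear_combination -he

end SmallMultiplier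

section Gaps

variable {t : ℕ} (R : Finset (ZMod t))

/-- The least `j ≥ 1` such that going down from `i` by `j` steps of length `h` leads into `R`. -/
noncomputable def gap (i h : ZMod t) : ℕ := sInf {j : ℕ | 1 ≤ j ∧ i - j * h ∈ R}

/-- The next element of `R` going down from `i` in steps of length `h`. -/
noncomputable def gapNext (i h : ZMod t) : ZMod t := i - gap R i h * h

variable {R} {i h : ZMod t}

lemma notMem_of_lt_gap {j : ℕ} (h1 : 1 ≤ j) (h2 : j < gap R i h) : i - j * h ∉ R := fun hm =>
  h2.not_ge (Nat.sInf_le ⟨h1, hm⟩)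

lemma eq_of_sub_mul_eq {i' : ZMod t} (hi : i ∈ R) {j j' : ℕ} (hjj : j ≤ j')
    (h0 : j' - j < gap R i' h) (he : i - j * h = i' - j' * h) : i = i' ∧ j = j' := by
  have e : i = i' - ((j' - j : ℕ) : ZMod t) * h := by
    rw [Nat.cast_sub hjj]
    linear_combination he
  have hz : j' - j = 0 := by
    by_contra hne
    exact notMem_of_lt_gap (Nat.one_le_iff_ne_zero.2 hne) h0 (e ▸ hi)
  rw [hz] at e
  exact ⟨by simpa using e, by omega⟩

variable [NeZero t]

lemma gap_spec (hi : i ∈ R) : 1 ≤ gap R i h ∧ i - gap R i h * h ∈ R :=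
  Nat.sInf_mem (s := {j : ℕ | 1 ≤ j ∧ i - j * h ∈ R})
    ⟨t, Nat.one_le_iff_ne_zero.2 (NeZero.ne t), by simpa using hi⟩

lemma gap_pos (hi : i ∈ R) : 1 ≤ gap R i h := (gap_spec hi).1

lemma gapNext_mem (hi : i ∈ R) : gapNext R i h ∈ R := (gap_spec hi).2

lemma sum_gap_le (h : ZMod t) : ∑ i ∈ R, gap R i h ≤ t := by
  have hc : #(R.sigma fun i => range (gap R i h)) ≤ #(univ : Finset (ZMod t)) := by
    refine card_le_card_of_injOn (fun x => x.1 - x.2 * h) (fun _ _ => mem_univ _) ?_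
    rintro ⟨i, j⟩ hx ⟨i', j'⟩ hy he
    simp only [coe_sigma, Set.mem_sigma_iff, mem_coe, mem_range] at hx hy he
    rcases le_total j j' with hle | hle
    · obtain ⟨rfl, rfl⟩ := eq_of_sub_mul_eq hx.1 hle (by omega) he
      rfl
    · obtain ⟨rfl, rfl⟩ := eq_of_sub_mul_eq hy.1 hle (by omega) he.symm
      rfl
  simpa [card_sigma, ZMod.card] using hc

lemma injOn_gapNext (h : ZMod t) : Set.InjOn (fun i => gapNext R i h) R := by
  intro i hi i' hi' he
  have g1 := gap_pos (h := h) hi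
  have g2 := gap_pos (h := h) hi'
  rcases le_total (gap R i h) (gap R i' h) with hle | hle
  · exact (eq_of_sub_mul_eq hi hle (by omega) he).1
  · exact (eq_of_sub_mul_eq hi' hle (by omega) he.symm).1.symm

lemma sum_comp_gapNext (h : ZMod t) (f : ZMod t → ℝ) :
    ∑ i ∈ R, f (gapNext R i h) = ∑ i ∈ R, f i := by
  refine sum_nbij (fun i => gapNext R i h) (fun i hi => gapNext_mem hi) (injOn_gapNext h) ?_
    (fun _ _ => rfl)
  exact surjOn_of_injOn_of_card_le _ (fun i hi => gapNext_mem hi) (injOn_gapNext h) le_rfl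

variable (R) in
/-- The density contributed by the class `h` of primes to the window below `i`. -/
noncomputable def gapWeight (i h : ZMod t) : ℝ :=
  1 / gap R i h - 1 / ((gap R i h + gap R (gapNext R i h) h : ℕ) : ℝ)

lemma card_sq_div_le_sum_gapWeight (hR : R.Nonempty) (h : ZMod t) :
    (#R : ℝ) ^ 2 / (2 * t) ≤ ∑ i ∈ R, gapWeight R i h := by
  have hg : ∀ i ∈ R, (0 : ℝ) < gap R i h := fun i hi => by exact_mod_cast gap_pos hi
  set S := ∑ i ∈ R, 1 / (gap R i h : ℝ) with hS
  have h1 : (1 / 2 : ℝ) * S ≤ ∑ i ∈ R, gapWeight R i h := by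
    have h2 : ∀ i ∈ R, 1 / (gap R i h : ℝ) - (1 / 4 * (1 / (gap R i h : ℝ)) +
        1 / 4 * (1 / (gap R (gapNext R i h) h : ℝ))) ≤ gapWeight R i h := by
      intro i hi
      have a := hg i hi
      have b := hg _ (gapNext_mem (h := h) hi)
      unfold gapWeight
      push_cast
      have : 1 / ((gap R i h : ℝ) + gap R (gapNext R i h) h) ≤
          1 / 4 * (1 / (gap R i h : ℝ)) + 1 / 4 * (1 / (gap R (gapNext R i h) h : ℝ)) := by
        generalize (gap R i h : ℝ) = x at *
        generalize (gap R (gapNext R i h) h : ℝ) = y at *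
        rw [← sub_nonneg]
        have : 1 / 4 * (1 / x) + 1 / 4 * (1 / y) - 1 / (x + y) =
            (x - y) ^ 2 / (4 * x * y * (x + y)) := by
          field_simp
          ring
        rw [this]
        positivity
      linarith
    refine le_trans (le_of_eq ?_) (sum_le_sum h2)
    rw [sum_sub_distrib, sum_add_distrib, ← mul_sum, ← mul_sum,
      sum_comp_gapNext h fun i => 1 / (gap R i h : ℝ)]
    ring
  have h3 : (#R : ℝ) ^ 2 / t ≤ S := by
    have := sq_sum_div_le_sum_sq_div R (fun _ => (1 : ℝ)) hg
    simp only [sum_const, nsmul_eq_mul, mul_one, one_pow] at this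
    refine le_trans ?_ this
    have hpos : (0 : ℝ) < ∑ i ∈ R, (gap R i h : ℝ) := sum_pos hg hR
    refine div_le_div_of_nonneg_left (sq_nonneg _) hpos ?_
    exact_mod_cast sum_gap_le h
  have : (#R : ℝ) ^ 2 / (2 * t) = 1 / 2 * ((#R : ℝ) ^ 2 / t) := by
    field_simp
  linarith

lemma exists_le_sum_units_gapWeight (hR : R.Nonempty) :
    ∃ i ∈ R, (t.totient : ℝ) * (#R / (2 * t)) ≤ ∑ h : (ZMod t)ˣ, gapWeight R i h := by
  refine exists_le_of_sum_le hR ?_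
  rw [sum_comm, sum_const, nsmul_eq_mul]
  calc (#R : ℝ) * (t.totient * (#R / (2 * t))) =
        ∑ _h : (ZMod t)ˣ, (#R : ℝ) ^ 2 / (2 * t) := by
          rw [sum_const, card_univ, ZMod.card_units_eq_totient, nsmul_eq_mul]
          ring
    _ ≤ _ := sum_le_sum fun h _ => card_sq_div_le_sum_gapWeight hR h

end Gaps

section SinglePrime

lemma not_dvd_den_div_mul {p : ℕ} (hp : p.Prime) {N E : ℤ} (hN : (p : ℤ) ∣ N)
    (hE : ¬ (p : ℤ) ∣ E) : ¬ p ∣ ((N : ℚ) / (p * E)).den := by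
  obtain ⟨N', rfl⟩ := hN
  have hp0 : (p : ℚ) ≠ 0 := by exact_mod_cast hp.ne_zero
  push_cast
  rw [mul_div_mul_left _ _ hp0]
  exact not_dvd_den_div N' E hE

lemma isSquare_intCast_of_modEq_one {D : ℤ} {p : ℕ} [Fact p.Prime]
    (hp : p ≡ 1 [MOD 4 * D.natAbs]) : IsSquare (D : ZMod p) := by
  rcases eq_or_ne D 0 with rfl | hD
  · simp
  have hD' : 0 < D.natAbs := Int.natAbs_pos.2 hD
  have hodd : Odd p := by
    have : p ≡ 1 [MOD 2] := hp.of_dvd ⟨2 * D.natAbs, by ring⟩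
    exact Nat.odd_iff.2 this
  have h1 : jacobiSym D p = 1 := by
    rw [jacobiSym.mod_right D hodd, hp, Nat.mod_eq_of_lt (by omega), jacobiSym.one_right]
  rw [← jacobiSym.legendreSym.to_jacobiSym] at h1
  by_cases h0 : (D : ZMod p) = 0
  · rw [h0]; exact ⟨0, by simp⟩
  · exact (legendreSym.eq_one_iff p h0).1 h1

lemma intCast_ne_zero_of_natAbs_lt {p : ℕ} {x : ℤ} (hx : x ≠ 0) (h : x.natAbs < p) :
    (x : ZMod p) ≠ 0 := by
  rw [Ne, ZMod.intCast_zmod_eq_zero_iff_dvd]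
  intro hd
  have := Nat.le_of_dvd (Int.natAbs_pos.2 hx) (Int.natCast_dvd.1 hd)
  omega

lemma exists_residue_two_terms {c : ℕ → ℤ} {α : ℕ} (hα : 0 < α) (h0 : c 0 ≠ 0) (h1 : c α ≠ 0)
    (hz : ∀ j, 0 < j → j < α → c j = 0) (hs : c 0 + c α ≠ 0) :
    ∃ P₀ : ℕ, ∀ p : ℕ, p.Prime → P₀ < p → ∃ κ : ZMod p, κ ≠ 0 ∧
      ∀ k : ℕ, (k : ZMod p) = κ →
        ¬ p ∣ (∑ j ∈ range (α + 1), (c j : ℚ) / (p * ((k : ℚ) - j))).den := by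
  refine ⟨(c 0 + c α).natAbs + (c 0 * α).natAbs + (c α * α).natAbs, fun p hp hP => ?_⟩
  have : Fact p.Prime := ⟨hp⟩
  have hα' : (α : ℤ) ≠ 0 := by exact_mod_cast hα.ne'
  have e1 := intCast_ne_zero_of_natAbs_lt (p := p) hs (by omega)
  have e2 := intCast_ne_zero_of_natAbs_lt (p := p) (mul_ne_zero h0 hα') (by omega)
  have e3 := intCast_ne_zero_of_natAbs_lt (p := p) (mul_ne_zero h1 hα') (by omega)
  push_cast at e1 e2 e3
  set κ : ZMod p := (c 0 * α) / (c 0 + c α) with hκ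
  have hroot : (c 0 : ZMod p) * (κ - α) + c α * κ = 0 := by
    rw [hκ]; field_simp; ring
  have hκ0 : κ ≠ 0 := div_ne_zero e2 e1
  have hκα : κ - α ≠ 0 := by
    intro h
    rw [sub_eq_zero.1 h, sub_self, mul_zero, zero_add] at hroot
    exact e3 hroot
  refine ⟨κ, hκ0, fun k hk => ?_⟩
  have hsum : ∑ j ∈ range (α + 1), (c j : ℚ) / (p * ((k : ℚ) - j)) =
      ((c 0 * ((k : ℤ) - α) + c α * k : ℤ) : ℚ) / (p * (((k : ℤ) * ((k : ℤ) - α) : ℤ) : ℚ)) := by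
    rw [← sum_subset (s₁ := {0, α}) (by
      intro x hx; simp only [mem_insert, mem_singleton] at hx; rw [mem_range]; omega) (by
      intro x hx hx'
      simp only [mem_insert, mem_singleton, not_or] at hx'
      rw [mem_range] at hx
      rw [hz x (by omega) (by omega)]
      simp), sum_pair hα.ne]
    have hp0 : (p : ℚ) ≠ 0 := by exact_mod_cast hp.ne_zero
    have hk0 : (k : ℚ) ≠ 0 := by
      rintro h
      have : k = 0 := by exact_mod_cast h
      rw [this] at hk
      exact hκ0 (by rw [← hk]; simp)
    have hkα : (k : ℚ) - α ≠ 0 := by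
      intro h
      have : k = α := by exact_mod_cast sub_eq_zero.1 h
      rw [this] at hk
      exact hκα (by rw [← hk]; simp)
    push_cast
    rw [sub_zero]
    field_simp
  rw [hsum]
  refine not_dvd_den_div_mul hp ?_ ?_
  · rw [← ZMod.intCast_zmod_eq_zero_iff_dvd]
    push_cast
    rw [hk, hroot]
  · rw [← ZMod.intCast_zmod_eq_zero_iff_dvd]
    push_cast
    rw [hk]
    exact mul_ne_zero hκ0 hκα

lemma exists_residue_three_terms {c : ℕ → ℤ} {α β : ℕ} (hα : 0 < α) (hαβ : α < β) (h0 : c 0 ≠ 0)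
    (h2 : c β ≠ 0) (hz : ∀ j, 0 < j → j < β → j ≠ α → c j = 0)
    (hs : c 0 + c α = 0) :
    ∃ M P₀ : ℕ, 0 < M ∧ ∀ p : ℕ, p.Prime → P₀ < p → p ≡ 1 [MOD M] → ∃ κ : ZMod p, κ ≠ 0 ∧
      ∀ k : ℕ, (k : ZMod p) = κ →
        ¬ p ∣ (∑ j ∈ range (β + 1), (c j : ℚ) / (p * ((k : ℚ) - j))).den := by
  obtain ⟨D, hD⟩ : ∃ D : ℤ, D = (c β + c 0) ^ 2 * α ^ 2 - 4 * c 0 * c β * α * β := ⟨_, rfl⟩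
  obtain ⟨M, hM0, hM⟩ : ∃ M : ℕ, 0 < M ∧ ∀ p : ℕ, [Fact p.Prime] → p ≡ 1 [MOD M] →
      IsSquare (D : ZMod p) := by
    rcases eq_or_ne D 0 with h | h
    · refine ⟨1, one_pos, fun p _ _ => ?_⟩
      rw [h]; exact ⟨0, by simp⟩
    · exact ⟨4 * D.natAbs, by have := Int.natAbs_pos.2 h; omega,
        fun p _ hp => isSquare_intCast_of_modEq_one hp⟩
  have hα' : (α : ℤ) ≠ 0 := by exact_mod_cast hα.ne'
  have hβ' : (β : ℤ) ≠ 0 := by exact_mod_cast (hα.trans hαβ).ne'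
  have hαβ' : (β : ℤ) - α ≠ 0 := by
    have : (α : ℤ) < β := by exact_mod_cast hαβ
    omega
  refine ⟨M, (2 * c β).natAbs + (c 0 * α * β).natAbs + (c 0 * α * (β - α)).natAbs +
    (c β * β * (β - α)).natAbs, hM0, fun p hp hP hpM => ?_⟩
  have : Fact p.Prime := ⟨hp⟩
  have e1 := intCast_ne_zero_of_natAbs_lt (p := p) (mul_ne_zero two_ne_zero h2) (by omega)
  have e2 := intCast_ne_zero_of_natAbs_lt (p := p) (mul_ne_zero (mul_ne_zero h0 hα') hβ')
    (by omega)
  have e3 := intCast_ne_zero_of_natAbs_lt (p := p) (mul_ne_zero (mul_ne_zero h0 hα') hαβ')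
    (by omega)
  have e4 := intCast_ne_zero_of_natAbs_lt (p := p) (mul_ne_zero (mul_ne_zero h2 hβ') hαβ')
    (by omega)
  push_cast at e1 e2 e3 e4
  have e5 := left_ne_zero_of_mul e1
  have e6 := right_ne_zero_of_mul e1
  have hc : c α = -c 0 := by omega
  obtain ⟨s, hsq⟩ := hM p hpM
  rw [hD] at hsq
  push_cast at hsq
  set κ : ZMod p := ((c β + c 0) * α + s) / (2 * c β) with hκ
  have hroot : (c 0 : ZMod p) * (κ - α) * (κ - β) - c 0 * κ * (κ - β) + c β * κ * (κ - α) = 0 := by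
    have h4 : (4 * c β : ZMod p) ≠ 0 := by
      have : (4 * c β : ZMod p) = 2 * (2 * c β) := by ring
      rw [this]
      exact mul_ne_zero e5 e1
    have hk2 : 2 * c β * κ = (c β + c 0) * α + s := by rw [hκ]; field_simp
    have : (4 * c β : ZMod p) * (c 0 * (κ - α) * (κ - β) - c 0 * κ * (κ - β) +
        c β * κ * (κ - α)) = 0 := by
      linear_combination (2 * c β * κ - (c β + c 0) * α + s) * hk2 - hsq
    exact (mul_eq_zero.1 this).resolve_left h4
  have hκ0 : κ ≠ 0 := by
    intro h
    rw [h] at hroot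
    exact e2 (by linear_combination hroot)
  have hκα : κ - α ≠ 0 := by
    intro h
    rw [sub_eq_zero.1 h] at hroot
    exact e3 (by linear_combination hroot)
  have hκβ : κ - β ≠ 0 := by
    intro h
    rw [sub_eq_zero.1 h] at hroot
    exact e4 (by linear_combination hroot)
  refine ⟨κ, hκ0, fun k hk => ?_⟩
  have hsum : ∑ j ∈ range (β + 1), (c j : ℚ) / (p * ((k : ℚ) - j)) =
      ((c 0 * ((k : ℤ) - α) * ((k : ℤ) - β) - c 0 * k * ((k : ℤ) - β) +
        c β * k * ((k : ℤ) - α) : ℤ) : ℚ) /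
      (p * (((k : ℤ) * ((k : ℤ) - α) * ((k : ℤ) - β) : ℤ) : ℚ)) := by
    rw [← sum_subset (s₁ := {0, α, β}) (by
      intro x hx; simp only [mem_insert, mem_singleton] at hx; rw [mem_range]; omega) (by
      intro x hx hx'
      simp only [mem_insert, mem_singleton, not_or] at hx'
      rw [mem_range] at hx
      rw [hz x (by omega) (by omega) (by omega)]
      simp), sum_insert (by simp; omega), sum_pair hαβ.ne, hc]
    have hp0 : (p : ℚ) ≠ 0 := by exact_mod_cast hp.ne_zero
    have hk0 : (k : ℚ) ≠ 0 := by
      rintro h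
      have : k = 0 := by exact_mod_cast h
      rw [this] at hk
      exact hκ0 (by rw [← hk]; simp)
    have hkα : (k : ℚ) - α ≠ 0 := by
      intro h
      have : k = α := by exact_mod_cast sub_eq_zero.1 h
      rw [this] at hk
      exact hκα (by rw [← hk]; simp)
    have hkβ : (k : ℚ) - β ≠ 0 := by
      intro h
      have : k = β := by exact_mod_cast sub_eq_zero.1 h
      rw [this] at hk
      exact hκβ (by rw [← hk]; simp)
    push_cast
    rw [sub_zero]
    field_simp
    ring
  rw [hsum]
  refine not_dvd_den_div_mul hp ?_ ?_
  · rw [← ZMod.intCast_zmod_eq_zero_iff_dvd]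
    push_cast
    rw [hk, hroot]
  · rw [← ZMod.intCast_zmod_eq_zero_iff_dvd]
    push_cast
    rw [hk]
    exact mul_ne_zero (mul_ne_zero hκ0 hκα) hκβ

lemma exists_residue_killing_prime {c : ℕ → ℤ} {α β : ℕ} (hα : 0 < α) (hαβ : α < β)
    (h0 : c 0 ≠ 0) (h1 : c α ≠ 0) (h2 : c β ≠ 0)
    (hz : ∀ j, 0 < j → j < β → j ≠ α → c j = 0) :
    ∃ J M P₀ : ℕ, (J = α ∨ J = β) ∧ 0 < M ∧
      ∀ p : ℕ, p.Prime → P₀ < p → p ≡ 1 [MOD M] → ∃ κ : ZMod p, κ ≠ 0 ∧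
        ∀ k : ℕ, (k : ZMod p) = κ →
          ¬ p ∣ (∑ j ∈ range (J + 1), (c j : ℚ) / (p * ((k : ℚ) - j))).den := by
  by_cases hs : c 0 + c α = 0
  · obtain ⟨M, P₀, hM, h⟩ := exists_residue_three_terms hα hαβ h0 h2 hz hs
    exact ⟨β, M, P₀, Or.inr rfl, hM, h⟩
  · obtain ⟨P₀, h⟩ := exists_residue_two_terms hα h0 h1
      (fun j hj hjα => hz j hj (hjα.trans hαβ) hjα.ne) hs
    exact ⟨α, 1, P₀, Or.inl rfl, one_pos, fun p hp hP _ => h p hp hP⟩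

end SinglePrime

section PeriodicSums

variable {t : ℕ} {ρ : ZMod t → ℤ} {r : ℕ → ℤ} {i : ZMod t}

lemma not_dvd_den_sum_Icc (hr : ∀ n, 1 ≤ n → r n = ρ n) {p k J : ℕ} (hp : p.Prime)
    (hpt : (p : ZMod t) = 1) (hJ : J < k) (hi : (k : ZMod t) = i)
    (h : ¬ p ∣ (∑ j ∈ range (J + 1), ((ρ (i - j) : ℤ) : ℚ) / (p * ((k : ℚ) - j))).den) :
    ¬ p ∣ (∑ n ∈ Icc (p * (k - J)) (p * k), (r n : ℚ) / n).den := by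
  rw [← sum_filter_add_sum_filter_not _ (fun n => p ∣ n)]
  refine not_dvd_den_add hp ?_ (not_dvd_den_sum hp _ _ fun n hn => ?_)
  · convert h using 3
    symm
    have hp0 := hp.pos
    refine sum_nbij' (fun j => p * (k - j)) (fun n => k - n / p) ?_ ?_ ?_ ?_ ?_
    · intro j hj
      rw [mem_range] at hj
      rw [mem_filter, mem_Icc]
      exact ⟨⟨Nat.mul_le_mul_left _ (by omega), Nat.mul_le_mul_left _ (by omega)⟩, dvd_mul_right _ _⟩
    · intro n hn
      rw [mem_filter, mem_Icc] at hn
      obtain ⟨⟨h1, h2⟩, m, rfl⟩ := hn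
      have h1 := Nat.le_of_mul_le_mul_left h1 hp0
      simp only [Nat.mul_div_cancel_left m hp0, mem_range]
      omega
    · intro j hj
      rw [mem_range] at hj
      simp only [Nat.mul_div_cancel_left _ hp0]
      omega
    · intro n hn
      rw [mem_filter, mem_Icc] at hn
      obtain ⟨⟨h1, h2⟩, m, rfl⟩ := hn
      have h2 := Nat.le_of_mul_le_mul_left h2 hp0
      simp only [Nat.mul_div_cancel_left m hp0]
      congr 1
      omega
    · intro j hj
      rw [mem_range] at hj
      have hjk : j ≤ k := by omega
      rw [hr _ (Nat.mul_pos hp0 (by omega))]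
      push_cast [Nat.cast_sub hjk]
      rw [hpt, hi, one_mul]
  · rw [mem_filter] at hn
    have := not_dvd_den_div (q := p) (r n) (n : ℤ) (by exact_mod_cast hn.2)
    simpa using this

lemma dvd_den_sum_Icc_of_gap [NeZero t] (hr : ∀ n, 1 ≤ n → r n = ρ n) {R : Finset (ZMod t)}
    (hR : ∀ x, x ∈ R ↔ ρ x ≠ 0) {q b n : ℕ} {h : ZMod t} (hq : q.Prime) (hqh : (q : ZMod t) = h)
    (hqb : q ∣ b) (hb : (b : ZMod t) = i) (hi : i ∈ R) (hn : n < b) (h1 : q * gap R i h ≤ n)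
    (h2 : n < q * (gap R i h + gap R (gapNext R i h) h)) (hρ : ¬ (q : ℤ) ∣ ρ (gapNext R i h)) :
    q ∣ (∑ m ∈ Icc (b - n) (b - 1), (r m : ℚ) / m).den := by
  have hg := gap_pos (h := h) hi
  have hqg : q * 1 ≤ q * gap R i h := Nat.mul_le_mul_left _ hg
  have hq0 := hq.pos
  have hcast : ∀ j, q * j ≤ b → ((b - q * j : ℕ) : ZMod t) = i - j * h := fun j hj => by
    push_cast [Nat.cast_sub hj]
    rw [hb, hqh, mul_comm]
  refine dvd_den_sum_of_unique hq r (i₀ := b - q * gap R i h) ?_ (by omega)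
    (Nat.dvd_sub hqb (dvd_mul_right _ _)) ?_ ?_
  · rw [mem_Icc]
    omega
  · rw [hr _ (by omega), hcast _ (by omega)]
    exact hρ
  · intro m hm hqm hne
    rw [mem_Icc] at hm
    obtain ⟨j, hj⟩ := Nat.dvd_sub hqb hqm
    have hm' : m = b - q * j := by omega
    subst hm'
    have hj0 : 1 ≤ j := by
      rcases Nat.eq_zero_or_pos j with rfl | hj0
      · omega
      · exact hj0
    have hjn : q * j < q * (gap R i h + gap R (gapNext R i h) h) := by omega
    have hj2 := Nat.lt_of_mul_lt_mul_left hjn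
    have hjg : j ≠ gap R i h := fun e => hne (by rw [e])
    rw [hr _ (by omega), hcast _ (by omega)]
    by_contra hc
    rw [← ne_eq, ← hR] at hc
    rcases lt_or_gt_of_ne hjg with hlt | hlt
    · exact notMem_of_lt_gap hj0 hlt hc
    · have hlt' : j - gap R i h < gap R (gapNext R i h) h := by omega
      refine notMem_of_lt_gap (by omega) hlt' ?_
      have e : gapNext R i h - ((j - gap R i h : ℕ) : ZMod t) * h = i - j * h := by
        unfold gapNext
        push_cast [Nat.cast_sub hlt.le]
        ring
      rwa [e]

end PeriodicSums

lemma isUnit_prod_natCast {R ι : Type*} [CommSemiring R] {s : Finset ι} {f : ι → ℕ}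
    (h : ∀ x ∈ s, IsUnit ((f x : ℕ) : R)) : IsUnit ((∏ x ∈ s, f x : ℕ) : R) := by
  rw [Nat.cast_prod]
  exact prod_induction _ IsUnit (fun _ _ => IsUnit.mul) isUnit_one h

/-- Given a prime `p` dividing no denominator of the window ending at a suitable residue class, and
a supply `S` of primes dividing the denominators, the denominator drops at some `b` that is
almost as large as `∏ q ∈ S, q`. -/
lemma exists_bfun_le {t : ℕ} [NeZero t] {ρ : ZMod t → ℤ} {r : ℕ → ℤ}
    (hr : ∀ n, 1 ≤ n → r n = ρ n) {R : Finset (ZMod t)} (hR : ∀ x, x ∈ R ↔ ρ x ≠ 0)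
    {i : ZMod t} (hi : i ∈ R) {p J : ℕ} (hp : p.Prime) (hpt : (p : ZMod t) = 1) (h4 : 4 * t ≤ p)
    (hρp : ¬ (p : ℤ) ∣ ρ i) {κ : ZMod p} (hκ : κ ≠ 0)
    (hκk : ∀ k : ℕ, (k : ZMod p) = κ →
      ¬ p ∣ (∑ j ∈ range (J + 1), ((ρ (i - j) : ℤ) : ℚ) / (p * ((k : ℚ) - j))).den)
    {S : Finset ℕ} (hS : ∀ q ∈ S, q.Prime ∧ q ≠ p ∧ IsUnit (q : ZMod t) ∧
      q * gap R i q ≤ p * J ∧ p * J < q * (gap R i q + gap R (gapNext R i q) q) ∧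
      ¬ (q : ℤ) ∣ ρ (gapNext R i q))
    {A A' : Finset ℕ} (hAS : A ⊆ S) (hA'S : A' ⊆ S) (hd : Disjoint A A')
    (hA1 : ∀ q ∈ A, (q : ZMod t) = 1) (hA'1 : ∀ q ∈ A', (q : ZMod t) = 1)
    (hA : Set.InjOn (fun a : ℕ => (a : ZMod p)) A) (hA' : Set.InjOn (fun a : ℕ => (a : ZMod p)) A')
    (hcard : 16 * t ^ 2 * p < #A * #A') (hbig : 2 * (p * J) ^ 3 ≤ ∏ q ∈ S, q) :
    ∃ b, 2 * (p * J) ≤ b ∧ ∏ q ∈ S, q ≤ b * (p * J) ^ 2 ∧ bfun r (b - p * J) ≤ b := by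
  have : Fact p.Prime := ⟨hp⟩
  have ht : 1 ≤ t := Nat.one_le_iff_ne_zero.2 (NeZero.ne t)
  have hle : ∀ q ∈ S, q ≤ p * J := fun q hq =>
    (Nat.le_mul_of_pos_right q (gap_pos hi)).trans (hS q hq).2.2.2.1
  have hSp : ∀ q ∈ S, (q : ZMod p) ≠ 0 := fun q hq h0 => by
    rw [ZMod.natCast_eq_zero_iff] at h0
    exact (hS q hq).2.1 ((Nat.prime_dvd_prime_iff_eq hp (hS q hq).1).1 h0).symm
  set P := ∏ q ∈ S, q with hP
  have hPp : (P : ZMod p) ≠ 0 := by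
    rw [hP, Nat.cast_prod]
    exact prod_ne_zero_iff.2 hSp
  have hPt : IsUnit (P : ZMod t) := isUnit_prod_natCast fun q hq => (hS q hq).2.2.1
  obtain ⟨u, hu⟩ := hPt
  obtain ⟨q₁, hq₁, q₂, hq₂, m, hm1, hmp, hmt, hm⟩ := exists_small_multiplier ht h4
    (i * (u⁻¹ : (ZMod t)ˣ)) hA hA' (w := κ / P) (div_ne_zero hκ hPp) hcard
  have hne : q₂ ≠ q₁ := fun e => disjoint_left.1 hd hq₁ (e ▸ hq₂)
  set S' := (S.erase q₁).erase q₂ with hS'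
  set Q := ∏ q ∈ S', q with hQ
  have hPQ : P = q₁ * (q₂ * Q) := by
    rw [hP, hQ, hS', mul_prod_erase _ (fun q => q) (mem_erase.2 ⟨hne, hA'S hq₂⟩),
      mul_prod_erase _ (fun q => q) (hAS hq₁)]
  have hS'S : S' ⊆ S := (erase_subset _ _).trans (erase_subset _ _)
  have hkκ : ((m * Q : ℕ) : ZMod p) = κ := by
    have e : (P : ZMod p) = q₁ * (q₂ * Q) := by exact_mod_cast congrArg (Nat.cast (R := ZMod p)) hPQ
    rw [Nat.cast_mul, hm]
    field_simp
    rw [e]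
    ring
  have hki : ((m * Q : ℕ) : ZMod t) = i := by
    have e : (P : ZMod t) = q₁ * (q₂ * Q) := by exact_mod_cast congrArg (Nat.cast (R := ZMod t)) hPQ
    rw [hA1 _ hq₁, hA'1 _ hq₂, one_mul, one_mul, ← hu] at e
    rw [Nat.cast_mul, hmt, ← e, mul_assoc, Units.inv_mul, mul_one]
  have hbi : ((p * (m * Q) : ℕ) : ZMod t) = i := by rw [Nat.cast_mul, hpt, hki, one_mul]
  have hp0 := hp.pos
  have hPle : P ≤ p * (m * Q) * (p * J) ^ 2 := by
    have h1 : q₁ * q₂ ≤ (p * J) ^ 2 := by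
      rw [sq]
      exact Nat.mul_le_mul (hle _ (hAS hq₁)) (hle _ (hA'S hq₂))
    calc P = Q * (q₁ * q₂) := by rw [hPQ]; ring
      _ ≤ (p * (m * Q)) * (p * J) ^ 2 := Nat.mul_le_mul (by
        rw [← mul_assoc]
        exact Nat.le_mul_of_pos_left _ (by positivity)) h1
  have hJ : 0 < p * J := (hS _ (hAS hq₁)).1.pos.trans_le (hle _ (hAS hq₁))
  have hnb : 2 * (p * J) ≤ p * (m * Q) := by
    refine le_of_mul_le_mul_right (a := (p * J) ^ 2) ?_ (by positivity)
    calc 2 * (p * J) * (p * J) ^ 2 = 2 * (p * J) ^ 3 := by ring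
      _ ≤ _ := hbig.trans hPle
  have hlt : p * J < p * (m * Q) := by omega
  refine ⟨p * (m * Q), hnb, hPle, ?_⟩
  have hJk : J < m * Q := Nat.lt_of_mul_lt_mul_left hlt
  have hE := not_dvd_den_sum_Icc hr hp hpt hJk hki (hκk _ hkκ)
  rw [Nat.mul_sub] at hE
  refine bfun_le (by omega) (by omega) ?_
  have hsplit : ∑ n ∈ Icc (p * (m * Q) - p * J) (p * (m * Q)), (r n : ℚ) / n =
      ∑ n ∈ Icc (p * (m * Q) - p * J) (p * (m * Q) - 1), (r n : ℚ) / n +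
        (r (p * (m * Q)) : ℚ) / (p * (m * Q) : ℕ) := by
    obtain ⟨b, hb⟩ : ∃ b, p * (m * Q) = b + 1 := ⟨p * (m * Q) - 1, by omega⟩
    rw [hb, sum_Icc_succ_top (by omega)]
    rfl
  rw [hsplit] at hE ⊢
  refine den_add_lt hp hmp (mul_assoc p m Q).symm (by omega) ?_ ?_ ?_ hE
  · refine Nat.Coprime.prod_right fun q hq => ?_
    exact (Nat.coprime_primes hp (hS q (hS'S hq)).1).2 (hS q (hS'S hq)).2.1.symm
  · rw [hr _ (by omega), hbi]
    exact hρp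
  · refine prod_primes_dvd _ (fun q hq => (hS q (hS'S hq)).1.prime) fun q hq => ?_
    obtain ⟨h1, -, -, h3, h4, h5⟩ := hS q (hS'S hq)
    exact dvd_den_sum_Icc_of_gap hr hR h1 rfl
      (((dvd_prod_of_mem (fun q => q) hq).mul_left m).mul_left p) hbi hi hlt h3 h4 h5

section PrimesInIntervals
open Topology

variable {q : ℕ} (a : ZMod q)

/-- The primes in `(x, y]` in the residue class `a`. -/
noncomputable def primesAP (x y : ℝ) : Finset ℕ :=
  (Ioc ⌊x⌋₊ ⌊y⌋₊).filter fun p : ℕ => p.Prime ∧ (p : ZMod q) = a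

variable {a}

lemma mem_primesAP {x y : ℝ} (hx : 0 ≤ x) {p : ℕ} :
    p ∈ primesAP a x y ↔ (x < p ∧ (p : ℝ) ≤ y) ∧ p.Prime ∧ (p : ZMod q) = a := by
  rw [primesAP, mem_filter, mem_Ioc, Nat.floor_lt hx]
  refine and_congr_left fun h => and_congr_right fun _ => ?_
  exact Nat.le_floor_iff' h.1.ne_zero

lemma sum_log_primesAP {x y : ℝ} (hxy : x ≤ y) :
    ∑ p ∈ primesAP a x y, Real.log p = thetaAP a y - thetaAP a x := by
  have hf := Nat.floor_mono hxy
  have hI : Icc 1 ⌊y⌋₊ = Icc 1 ⌊x⌋₊ ∪ Ioc ⌊x⌋₊ ⌊y⌋₊ := by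
    ext k
    simp only [mem_union, mem_Icc, mem_Ioc]
    omega
  rw [eq_sub_iff_add_eq, add_comm, thetaAP, thetaAP, primesAP, hI, filter_union, sum_union]
  refine disjoint_filter_filter (disjoint_left.2 fun k h1 h2 => ?_)
  rw [mem_Icc] at h1
  rw [mem_Ioc] at h2
  omega

lemma tendsto_thetaAP_mul_div [NeZero q] (ha : IsUnit a) {x : ℝ} (hx : 0 < x) :
    Tendsto (fun n : ℕ => thetaAP a (x * n) / n) atTop (𝓝 ((q.totient : ℝ)⁻¹ * x)) := by
  have h := ((tendsto_thetaAP_div a ha).comp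
    (tendsto_natCast_atTop_atTop.const_mul_atTop hx)).mul_const x
  refine h.congr fun n => ?_
  simp only [Function.comp]
  field_simp

lemma tendsto_sum_log_primesAP [NeZero q] (ha : IsUnit a) {x y : ℝ} (hx : 0 < x) (hxy : x ≤ y) :
    Tendsto (fun n : ℕ => (∑ p ∈ primesAP a (x * n) (y * n), Real.log p) / n) atTop
      (𝓝 ((q.totient : ℝ)⁻¹ * (y - x))) := by
  have h := (tendsto_thetaAP_mul_div ha (hx.trans_le hxy)).sub (tendsto_thetaAP_mul_div ha hx)
  rw [← mul_sub] at h
  refine h.congr fun n => ?_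
  rw [sum_log_primesAP (by gcongr), sub_div]

lemma eventually_le_card_primesAP [NeZero q] (ha : IsUnit a) {x y : ℝ} (hx : 0 < x) (hxy : x < y)
    (K : ℝ) : ∀ᶠ n : ℕ in atTop, K * √n ≤ #(primesAP a (x * n) (y * n)) := by
  have hy : 0 < y := hx.trans hxy
  have hφ : (0 : ℝ) < (q.totient : ℝ)⁻¹ := by
    have := Nat.totient_pos.2 (NeZero.pos q)
    positivity
  have hc : 0 < (q.totient : ℝ)⁻¹ * (y - x) := mul_pos hφ (sub_pos.2 hxy)
  have hlog : Tendsto (fun n : ℕ => K * √n * Real.log (y * n) / n) atTop (𝓝 0) := by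
    have h := ((isLittleO_log_rpow_atTop (r := 1 / 2) (by norm_num)).tendsto_div_nhds_zero.comp
      ((tendsto_natCast_atTop_atTop (R := ℝ)).const_mul_atTop hy)).const_mul (K * √y)
    rw [mul_zero] at h
    refine h.congr' ?_
    filter_upwards [eventually_gt_atTop 0] with n hn
    have hn' : (0 : ℝ) < n := by exact_mod_cast hn
    have h1 : 0 < √(n : ℝ) := Real.sqrt_pos.2 hn'
    have h2 : 0 < √y := Real.sqrt_pos.2 hy
    have h3 := Real.sq_sqrt hn'.le
    simp only [Function.comp]
    rw [← Real.sqrt_eq_rpow, Real.sqrt_mul hy.le]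
    field_simp
    rw [h3]
    ring
  filter_upwards [((tendsto_sum_log_primesAP ha hx hxy.le).eventually_const_lt (half_lt_self hc)),
    hlog.eventually_lt_const (half_pos hc), eventually_gt_atTop 0,
    ((tendsto_natCast_atTop_atTop (R := ℝ)).const_mul_atTop hy).eventually_gt_atTop 1]
    with n h1 h2 hn h3
  have hn' : (0 : ℝ) < n := by exact_mod_cast hn
  have hl := Real.log_pos h3
  have h4 := (div_lt_div_iff_of_pos_right hn').1 (h2.trans h1)
  refine le_of_mul_le_mul_right (h4.le.trans ?_) hl
  rw [← nsmul_eq_mul]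
  refine sum_le_card_nsmul _ _ _ fun p hp => ?_
  rw [mem_primesAP (by positivity)] at hp
  exact Real.log_le_log (by exact_mod_cast hp.2.1.pos) hp.1.2

end PrimesInIntervals

section WindowPrimes
open Topology

variable {t : ℕ} [NeZero t] {R : Finset (ZMod t)} {i : ZMod t}

lemma gap_le (hi : i ∈ R) (h : ZMod t) : gap R i h ≤ t :=
  (single_le_sum (fun _ _ => Nat.zero_le _) hi).trans (sum_gap_le h)

variable (R i) in
/-- The primes `q` for which exactly one multiple of `q` among the `n` integers preceding one in
the class `i` lies outside the zeros of the sequence. -/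
noncomputable def windowPrimes (n : ℕ) : Finset ℕ :=
  univ.biUnion fun h : (ZMod t)ˣ => primesAP (h : ZMod t)
    (1 / ((gap R i h + gap R (gapNext R i h) h : ℕ) : ℝ) * n) (1 / (gap R i h : ℝ) * n)

lemma mem_windowPrimes (hi : i ∈ R) {n q : ℕ} : q ∈ windowPrimes R i n ↔
    q.Prime ∧ IsUnit (q : ZMod t) ∧ q * gap R i q ≤ n ∧
      n < q * (gap R i q + gap R (gapNext R i q) q) := by
  have key : ∀ h : ZMod t, q ∈ primesAP h
      (1 / ((gap R i h + gap R (gapNext R i h) h : ℕ) : ℝ) * n) (1 / (gap R i h : ℝ) * n) ↔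
      (n < q * (gap R i h + gap R (gapNext R i h) h) ∧ q * gap R i h ≤ n) ∧
        q.Prime ∧ (q : ZMod t) = h := by
    intro h
    have g1 : (0 : ℝ) < gap R i h := by exact_mod_cast gap_pos hi
    have g2 : (0 : ℝ) < ((gap R i h + gap R (gapNext R i h) h : ℕ) : ℝ) := by
      push_cast
      positivity
    rw [mem_primesAP (by positivity), one_div_mul_eq_div, one_div_mul_eq_div, div_lt_iff₀ g2,
      le_div_iff₀ g1]
    norm_cast
  simp only [windowPrimes, mem_biUnion, mem_univ, true_and, key]
  constructor
  · rintro ⟨h, ⟨h1, h2⟩, h3, h4⟩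
    rw [h4]
    exact ⟨h3, h.isUnit, h2, h1⟩
  · rintro ⟨h1, ⟨h, hh⟩, h3, h4⟩
    refine ⟨h, ?_⟩
    rw [hh]
    exact ⟨⟨h4, h3⟩, h1, rfl⟩

lemma tendsto_sum_log_windowPrimes (hi : i ∈ R) :
    Tendsto (fun n : ℕ => (∑ q ∈ windowPrimes R i n, Real.log q) / n) atTop
      (𝓝 ((t.totient : ℝ)⁻¹ * ∑ h : (ZMod t)ˣ, gapWeight R i h)) := by
  have hs : ∀ n : ℕ, (∑ q ∈ windowPrimes R i n, Real.log q) / n =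
      ∑ h : (ZMod t)ˣ, (∑ q ∈ primesAP (h : ZMod t)
        (1 / ((gap R i h + gap R (gapNext R i h) h : ℕ) : ℝ) * n) (1 / (gap R i h : ℝ) * n),
        Real.log q) / n := by
    intro n
    rw [windowPrimes, sum_biUnion, sum_div]
    intro h _ h' _ hne
    refine disjoint_left.2 fun q h1 h2 => hne (Units.ext ?_)
    simp only [primesAP, mem_filter] at h1 h2
    exact h1.2.2.symm.trans h2.2.2
  simp only [hs, mul_sum]
  refine tendsto_finsetSum _ fun h _ => ?_
  have g1 : (0 : ℝ) < gap R i h := by exact_mod_cast gap_pos hi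
  refine tendsto_sum_log_primesAP h.isUnit ?_ ?_
  · push_cast
    positivity
  · push_cast
    gcongr
    linarith [(Nat.cast_nonneg (gap R (gapNext R i h) h) : (0 : ℝ) ≤ _)]

/-- The window primes in the class `1` contain two disjoint large sets injecting into `ZMod p`. -/
lemma exists_disjoint_window_subsets (hi : i ∈ R) {n p : ℕ} (hpn : p ≤ n) (hn0 : 0 < n)
    (hnp : n ≤ p * (gap R i 1 + gap R (gapNext R i 1) 1))
    (h : (8 * t + 4) * √n ≤ #(primesAP (1 : ZMod t)
      (1 / ((gap R i 1 + gap R (gapNext R i 1) 1 : ℕ) : ℝ) * n)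
      ((1 + 1 / (2 * t)) / ((gap R i 1 + gap R (gapNext R i 1) 1 : ℕ) : ℝ) * n))) :
    ∃ A A' : Finset ℕ, A ⊆ (windowPrimes R i n).erase p ∧ A' ⊆ (windowPrimes R i n).erase p ∧
      Disjoint A A' ∧ (∀ q ∈ A, (q : ZMod t) = 1) ∧ (∀ q ∈ A', (q : ZMod t) = 1) ∧
      Set.InjOn (fun a : ℕ => (a : ZMod p)) A ∧ Set.InjOn (fun a : ℕ => (a : ZMod p)) A' ∧
      16 * t ^ 2 * p < #A * #A' := by
  have ht0 : (1 : ℝ) ≤ t := by exact_mod_cast Nat.one_le_iff_ne_zero.2 (NeZero.ne t)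
  have g1 : (1 : ℝ) ≤ gap R i 1 := by exact_mod_cast gap_pos hi
  have g2 : (1 : ℝ) ≤ gap R (gapNext R i 1) 1 := by exact_mod_cast gap_pos (gapNext_mem hi)
  have g3 : (gap R i 1 : ℝ) ≤ t := by exact_mod_cast gap_le hi 1
  have hn1 : (1 : ℝ) ≤ n := by exact_mod_cast hn0
  have hnp' : (n : ℝ) ≤ p * ((gap R i 1 + gap R (gapNext R i 1) 1 : ℕ) : ℝ) := by
    exact_mod_cast hnp
  set β : ℝ := ((gap R i 1 + gap R (gapNext R i 1) 1 : ℕ) : ℝ) with hβ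
  have hβ' : β = gap R i 1 + gap R (gapNext R i 1) 1 := by rw [hβ]; push_cast; rfl
  have hβ0 : 0 < β := by linarith
  set W₀ := primesAP (1 : ZMod t) (1 / β * n) ((1 + 1 / (2 * t)) / β * n) with hW₀
  have hmem : ∀ q, q ∈ W₀ ↔ (1 / β * n < q ∧ (q : ℝ) ≤ (1 + 1 / (2 * t)) / β * n) ∧ q.Prime ∧
      (q : ZMod t) = 1 := fun q => mem_primesAP (by positivity)
  have hsub : ∀ q ∈ W₀, q ∈ windowPrimes R i n := by
    intro q hq
    rw [hmem] at hq
    obtain ⟨⟨h1, h2⟩, h3, h4⟩ := hq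
    rw [mem_windowPrimes hi, h4]
    refine ⟨h3, isUnit_one, ?_, ?_⟩
    · have : (q : ℝ) * gap R i 1 ≤ n := by
        have h5 : (1 + 1 / (2 * (t : ℝ))) * gap R i 1 ≤ β := by
          rw [hβ', add_mul, one_mul, one_div_mul_eq_div]
          have : (gap R i 1 : ℝ) / (2 * t) ≤ 1 := by
            rw [div_le_one (by positivity)]
            linarith
          linarith
        calc (q : ℝ) * gap R i 1 ≤ (1 + 1 / (2 * t)) / β * n * gap R i 1 := by gcongr
          _ = (1 + 1 / (2 * (t : ℝ))) * gap R i 1 / β * n := by ring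
          _ ≤ 1 * n := by
            gcongr
            rwa [div_le_one hβ0]
          _ = n := one_mul _
      exact_mod_cast this
    · rw [one_div_mul_eq_div, div_lt_iff₀ hβ0, hβ] at h1
      exact_mod_cast h1
  have hinj : Set.InjOn (fun a : ℕ => (a : ZMod p)) W₀ := by
    have key : ∀ q ∈ W₀, ∀ q' ∈ W₀, q ≤ q' → (q : ZMod p) = q' → q = q' := by
      intro q hq q' hq' hle he
      rw [hmem] at hq hq'
      rw [ZMod.natCast_eq_natCast_iff, Nat.modEq_iff_dvd' hle] at he
      have hlt : (q' : ℝ) < q + p := by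
        have h5 : (1 + 1 / (2 * (t : ℝ))) / β * n = 1 / β * n + 1 / (2 * t) * (n / β) := by ring
        have h6 : (n : ℝ) / β ≤ p := by rwa [div_le_iff₀ hβ0]
        have h7 : 1 / (2 * (t : ℝ)) ≤ 1 := by
          rw [div_le_one (by positivity)]
          linarith
        have h8 : 1 / (2 * (t : ℝ)) * (n / β) ≤ 1 * p := by gcongr
        linarith [hq.1.1, hq'.1.2]
      have hlt' : q' < q + p := by exact_mod_cast hlt
      have := Nat.eq_zero_of_dvd_of_lt he (by omega)
      omega
    intro q hq q' hq' he
    rcases le_total q q' with hle | hle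
    · exact key q hq q' hq' hle he
    · exact (key q' hq' q hq hle he.symm).symm
  set W := W₀.erase p with hW
  have hWc : #W₀ ≤ #W + 1 := by
    have := pred_card_le_card_erase (s := W₀) (a := p)
    rw [← hW] at this
    omega
  obtain ⟨A, hAW, hA⟩ := exists_subset_card_eq (Nat.div_le_self #W 2)
  obtain ⟨A', hA'W, hA'⟩ := exists_subset_card_eq (s := W \ A) (n := #W / 2) (by
    rw [card_sdiff_of_subset hAW]
    omega)
  have hA'W' : A' ⊆ W := hA'W.trans sdiff_subset
  have hWW : W ⊆ W₀ := erase_subset _ _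
  have hWS : W ⊆ (windowPrimes R i n).erase p := erase_subset_erase _ hsub
  refine ⟨A, A', hAW.trans hWS, hA'W'.trans hWS,
    disjoint_of_subset_right hA'W disjoint_sdiff, fun q hq => ((hmem q).1 (hWW (hAW hq))).2.2,
    fun q hq => ((hmem q).1 (hWW (hA'W' hq))).2.2, hinj.mono (coe_subset.2 (hAW.trans hWW)),
    hinj.mono (coe_subset.2 (hA'W'.trans hWW)), ?_⟩
  rw [hA, hA']
  have hs1 : (1 : ℝ) ≤ √n := by simpa using Real.sqrt_le_sqrt hn1
  have hs : 4 * (t : ℝ) * √n < (#W / 2 : ℕ) := by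
    have h1 : #W₀ ≤ 2 * (#W / 2) + 2 := by omega
    have h2 : (#W₀ : ℝ) ≤ 2 * (#W / 2 : ℕ) + 2 := by exact_mod_cast h1
    linarith
  have : (16 * t ^ 2 * p : ℝ) < (#W / 2 : ℕ) * (#W / 2 : ℕ) := by
    have h3 : (p : ℝ) ≤ n := by exact_mod_cast hpn
    calc (16 * t ^ 2 * p : ℝ) ≤ 16 * t ^ 2 * n := by gcongr
      _ = (4 * t * √n) * (4 * t * √n) := by
        nth_rewrite 1 [← Real.mul_self_sqrt (Nat.cast_nonneg n)]
        ring
      _ < _ := by gcongr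
  exact_mod_cast this

end WindowPrimes

section Liminf
open Topology

variable {t : ℕ} [NeZero t] {ρ : ZMod t → ℤ} {r : ℕ → ℤ} {R : Finset (ZMod t)}

/-- If `ρ` is the sequence of period `t` with support `R`, then `b(a) - a ≤ c log a` infinitely
often, for every `c > 2 t / |R|`. -/
lemma frequently_bfun_sub_le (hr : ∀ n, 1 ≤ n → r n = ρ n) (hR : ∀ x, x ∈ R ↔ ρ x ≠ 0)
    (hne : R.Nonempty) {c : ℝ} (hc : 2 * t / #R < c) :
    ∃ᶠ a : ℕ in atTop, ((bfun r a : ℝ) - a) / Real.log a ≤ c := by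
  have ht : 1 ≤ t := Nat.one_le_iff_ne_zero.2 (NeZero.ne t)
  have ht0 : (1 : ℝ) ≤ t := by exact_mod_cast ht
  have hR0 : (0 : ℝ) < #R := by exact_mod_cast hne.card_pos
  have hc0 : 0 < c := lt_of_le_of_lt (by positivity) hc
  obtain ⟨i, hi, hF⟩ := exists_le_sum_units_gapWeight hne
  have hφ : (0 : ℝ) < t.totient := by exact_mod_cast Nat.totient_pos.2 (NeZero.pos t)
  rw [← le_inv_mul_iff₀ hφ] at hF
  have hcF : 1 / c < #R / (2 * t) := by
    rw [one_div_lt hc0 (by positivity), one_div_div]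
    exact hc
  obtain ⟨G, hG1, hG2⟩ := exists_between (hcF.trans_le hF)
  have hG0 : 0 < G := lt_trans (by positivity) hG1
  set α := gap R i 1 with hα
  set β := gap R i 1 + gap R (gapNext R i 1) 1 with hβ
  have hα0 : 0 < α := gap_pos hi
  have hαβ : α < β := Nat.lt_add_of_pos_right (gap_pos (gapNext_mem hi))
  have hβt : β ≤ 2 * t := by
    have := gap_le hi 1
    have := gap_le (gapNext_mem (h := 1) hi) 1
    omega
  obtain ⟨J, M, P₀, hJ, hM, hκ⟩ := exists_residue_killing_prime (c := fun j => ρ (i - j)) hα0 hαβ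
    (by simpa using (hR _).1 hi) ((hR _).1 (by simpa [gapNext] using gapNext_mem (h := 1) hi))
    ((hR _).1 (by
      have := gapNext_mem (h := 1) (gapNext_mem (h := 1) hi)
      simp only [gapNext] at this ⊢
      rw [hβ]
      push_cast
      convert this using 1
      simp only [gapNext]
      ring))
    (fun j h0 h1 h2 => by
      by_contra hj
      have hj := (hR _).2 hj
      rcases lt_or_gt_of_ne h2 with h | h
      · exact notMem_of_lt_gap (h := 1) h0 h (by simpa using hj)
      · have hlt : j - α < gap R (gapNext R i 1) 1 := by omega
        refine notMem_of_lt_gap (by omega) hlt ?_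
        rw [gapNext, ← hα, Nat.cast_sub h.le]
        simpa using hj)
  have hJβ : J ≤ β := by omega
  have hJ0 : 0 < J := by omega
  obtain ⟨B, hB⟩ : ∃ B : ℕ, ∀ x, (ρ x).natAbs ≤ B :=
    ⟨univ.sup fun x => (ρ x).natAbs, fun x => le_sup (f := fun x => (ρ x).natAbs) (mem_univ x)⟩
  have hρ : ∀ q : ℕ, B < q → ∀ x ∈ R, ¬ (q : ℤ) ∣ ρ x := fun q hq x hx hd => by
    have := Nat.le_of_dvd (Int.natAbs_pos.2 ((hR x).1 hx)) (Int.natCast_dvd.1 hd)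
    exact absurd (this.trans (hB x)) hq.not_ge
  have hlog : Tendsto (fun n : ℕ => Real.log n / n) atTop (𝓝 0) := by
    have := (Real.isLittleO_log_id_atTop.tendsto_div_nhds_zero).comp
      (tendsto_natCast_atTop_atTop (R := ℝ))
    exact this
  have hlog2 : ∀ K C : ℝ, ∀ δ > 0, ∀ᶠ n : ℕ in atTop, K * Real.log n + C ≤ δ * n := by
    intro K C δ hδ
    have h1 := (hlog.const_mul K).add (tendsto_const_div_atTop_nhds_zero_nat C)
    rw [mul_zero, add_zero] at h1
    filter_upwards [h1.eventually_lt_const hδ, eventually_gt_atTop 0] with n h2 hn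
    have hn' : (0 : ℝ) < n := by exact_mod_cast hn
    rw [← mul_div_assoc, ← add_div, div_lt_iff₀ hn'] at h2
    exact h2.le
  obtain ⟨G', hG3, hG4⟩ := exists_between hG2
  have hsum : ∀ᶠ n : ℕ in atTop, G * n ≤ ∑ q ∈ windowPrimes R i n, Real.log q - Real.log n := by
    filter_upwards [(tendsto_sum_log_windowPrimes hi).eventually_const_lt hG4,
      hlog2 1 0 (G' - G) (sub_pos.2 hG3), eventually_gt_atTop 0] with n h1 h2 hn
    rw [lt_div_iff₀ (by exact_mod_cast hn)] at h1
    linarith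
  have hW := eventually_le_card_primesAP (q := t) (a := 1) isUnit_one (x := 1 / (β : ℝ))
    (y := (1 + 1 / (2 * t)) / (β : ℝ)) (by positivity) (by
      have : 0 < (β : ℝ) := by exact_mod_cast hα0.trans hαβ
      gcongr
      have : 0 < 1 / (2 * (t : ℝ)) := by positivity
      linarith) (8 * t + 4)
  obtain ⟨N₀, hN₀⟩ := eventually_atTop.1 (hsum.and (hW.and
    ((hlog2 2 (Real.log 2) (G - 1 / c) (sub_pos.2 hG1)).and (hlog2 3 (Real.log 2) G hG0))))
  rw [frequently_atTop]
  intro N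
  obtain ⟨p, hp, hpN, hp1⟩ := Nat.exists_prime_gt_modEq_one
    (N₀ + N + P₀ + 4 * t + B + 2 * t * (B + 1)) (k := t * M) (by positivity)
  set n := p * J with hn
  have hpn : p ≤ n := Nat.le_mul_of_pos_right _ hJ0
  obtain ⟨h1, h2, h3, h4⟩ := hN₀ n (by omega)
  have hn0 : 0 < n := hp.pos.trans_le hpn
  have hn0' : (0 : ℝ) < n := by exact_mod_cast hn0
  have hpt : (p : ZMod t) = 1 := by
    have := (ZMod.natCast_eq_natCast_iff p 1 t).2 (hp1.of_mul_right M)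
    simpa using this
  obtain ⟨κ, hκ0, hκk⟩ := hκ p hp (by omega) (hp1.of_mul_left t)
  obtain ⟨A, A', hA, hA', hd, hA1, hA'1, hAi, hA'i, hcard⟩ := exists_disjoint_window_subsets hi hpn
    hn0 (Nat.mul_le_mul_left p hJβ) h2
  have hgt : ∀ q ∈ windowPrimes R i n, B < q := by
    intro q hq
    have h5 := ((mem_windowPrimes hi).1 hq).2.2.2
    have h6 : gap R i q + gap R (gapNext R i q) q ≤ 2 * t := by
      have := gap_le hi q
      have := gap_le (gapNext_mem (h := q) hi) q
      omega
    by_contra hle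
    have := Nat.mul_le_mul (not_lt.1 hle) h6
    nlinarith
  set S := (windowPrimes R i n).erase p with hS
  have hPlog : G * n ≤ Real.log (∏ q ∈ S, q : ℕ) := by
    rw [Nat.cast_prod, Real.log_prod fun q hq => by
      exact_mod_cast ((mem_windowPrimes hi).1 (mem_of_mem_erase hq)).1.ne_zero]
    have : ∑ q ∈ windowPrimes R i n, Real.log q ≤ ∑ q ∈ S, Real.log q + Real.log n := by
      have hpl : Real.log p ≤ Real.log n :=
        Real.log_le_log (by exact_mod_cast hp.pos) (by exact_mod_cast hpn)
      by_cases hpm : p ∈ windowPrimes R i n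
      · rw [← sum_erase_add _ _ hpm]
        linarith
      · rw [hS, erase_eq_of_notMem hpm]
        linarith [Real.log_natCast_nonneg n]
    linarith
  have hPpos : 0 < ∏ q ∈ S, q := prod_pos fun q hq =>
    ((mem_windowPrimes hi).1 (mem_of_mem_erase hq)).1.pos
  have hbig : 2 * n ^ 3 ≤ ∏ q ∈ S, q := by
    have : Real.log (2 * n ^ 3 : ℕ) ≤ Real.log (∏ q ∈ S, q : ℕ) := by
      push_cast
      rw [Real.log_mul two_ne_zero (by positivity), Real.log_pow]
      push_cast at hPlog ⊢
      linarith
    exact_mod_cast (Real.log_le_log_iff (by positivity) (by positivity)).1 this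
  obtain ⟨b, hb1, hb2, hb3⟩ := exists_bfun_le hr hR hi hp hpt (by omega) (hρ p (by omega) i hi)
    hκ0 hκk (S := S) (fun q hq => by
      obtain ⟨hqp, hqw⟩ := mem_erase.1 hq
      obtain ⟨w1, w2, w3, w4⟩ := (mem_windowPrimes hi).1 hqw
      exact ⟨w1, hqp, w2, w3, w4, hρ q (hgt q hqw) _ (gapNext_mem hi)⟩) hA hA' hd hA1 hA'1 hAi
    hA'i hcard hbig
  rw [← hn] at hb1 hb2 hb3
  refine ⟨b - n, by omega, ?_⟩
  have hbn : n ≤ b := by omega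
  have hba : (b : ℝ) ≤ 2 * (b - n : ℕ) := by
    exact_mod_cast (by omega : b ≤ 2 * (b - n))
  have hb0 : (0 : ℝ) < b := by exact_mod_cast (by omega : 0 < b)
  have ha0 : (0 : ℝ) < (b - n : ℕ) := by exact_mod_cast (by omega : 0 < b - n)
  have hla : 1 / c * n ≤ Real.log (b - n : ℕ) := by
    have e1 : Real.log (∏ q ∈ S, q : ℕ) ≤ Real.log (b : ℝ) + 2 * Real.log n := by
      have e2 : ((∏ q ∈ S, q : ℕ) : ℝ) ≤ b * (n : ℝ) ^ 2 := by exact_mod_cast hb2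
      refine (Real.log_le_log (by exact_mod_cast hPpos) e2).trans (le_of_eq ?_)
      rw [Real.log_mul hb0.ne' (by positivity), Real.log_pow]
      push_cast
      rfl
    have e3 : Real.log b ≤ Real.log 2 + Real.log (b - n : ℕ) := by
      rw [← Real.log_mul two_ne_zero ha0.ne']
      exact Real.log_le_log hb0 hba
    linarith
  have hlpos : 0 < Real.log (b - n : ℕ) := lt_of_lt_of_le (by positivity) hla
  rw [div_le_iff₀ hlpos]
  have e4 : (bfun r (b - n) : ℝ) ≤ b := by exact_mod_cast hb3
  have e5 : (n : ℝ) ≤ c * Real.log (b - n : ℕ) := by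
    rw [one_div_mul_eq_div, div_le_iff₀ hc0] at hla
    linarith
  rw [Nat.cast_sub hbn] at e5 ⊢
  linarith

lemma liminf_bfun_sub_le (hr : ∀ n, 1 ≤ n → r n = ρ n) (hR : ∀ x, x ∈ R ↔ ρ x ≠ 0)
    (hne : R.Nonempty) :
    atTop.liminf (fun a : ℕ => ((bfun r a : ℝ) - a) / Real.log a) ≤ 2 * t / #R := by
  rw [liminf_eq]
  refine Real.sSup_le (fun x hx => le_of_forall_gt_imp_ge_of_dense fun c hc => ?_)
    (by positivity)
  obtain ⟨a, h1, h2⟩ := ((frequently_bfun_sub_le hr hR hne hc).and_eventually hx).exists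
  exact h2.trans h1

end Liminf

section TotientBounds
open Topology

lemma prod_pow_div_dvd_factorial (n : ℕ) : ∏ p ∈ n.primesLE, p ^ (n / p) ∣ n.factorial := by
  refine prod_dvd_of_isRelPrime (fun p hp q hq hpq => ?_) fun p hp => ?_
  · rw [mem_coe, Nat.mem_primesLE] at hp hq
    exact Nat.coprime_iff_isRelPrime.1 (Nat.coprime_pow_primes _ _ hp.2 hq.2 hpq)
  · rw [Nat.mem_primesLE] at hp
    rw [hp.2.pow_dvd_factorial_iff (b := Nat.log p n + 2) (by omega)]
    simpa using single_le_sum (f := fun i => n / p ^ i) (fun _ _ => Nat.zero_le _)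
      (mem_Ico.2 ⟨le_rfl, by omega⟩ : 1 ∈ Ico 1 (Nat.log p n + 2))

/-- The upper bound in Mertens' first theorem. -/
lemma sum_log_div_primesLE_le {n : ℕ} (hn : n ≠ 0) :
    ∑ p ∈ n.primesLE, Real.log p / p ≤ Real.log n + Real.log 4 := by
  have hn' : (0 : ℝ) < n := by exact_mod_cast Nat.pos_of_ne_zero hn
  have h1 : ∑ p ∈ n.primesLE, ((n / p : ℕ) : ℝ) * Real.log p ≤ n * Real.log n := by
    have h2 : ∏ p ∈ n.primesLE, p ^ (n / p) ≤ n ^ n :=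
      (Nat.le_of_dvd n.factorial_pos (prod_pow_div_dvd_factorial n)).trans (Nat.factorial_le_pow n)
    have h3 : ∀ p ∈ n.primesLE, (p : ℝ) ≠ 0 := fun p hp => by
      exact_mod_cast (Nat.mem_primesLE.1 hp).2.ne_zero
    have h4 : ((∏ p ∈ n.primesLE, p ^ (n / p) : ℕ) : ℝ) ≤ (n : ℝ) ^ n := by exact_mod_cast h2
    push_cast at h4
    have h5 := Real.log_le_log (prod_pos fun p hp => by
      have := (Nat.mem_primesLE.1 hp).2.pos
      positivity) h4
    rw [Real.log_pow, Real.log_prod fun p hp => pow_ne_zero _ (h3 p hp)] at h5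
    simpa only [Real.log_pow] using h5
  have h2 : ∑ p ∈ n.primesLE, Real.log p ≤ Real.log 4 * n := by
    rw [← Chebyshev.theta_eq_sum_primesLE_log]
    exact Chebyshev.theta_le_log4_mul_x hn'.le
  have h3 : n * ∑ p ∈ n.primesLE, Real.log p / p ≤
      ∑ p ∈ n.primesLE, ((n / p : ℕ) : ℝ) * Real.log p + ∑ p ∈ n.primesLE, Real.log p := by
    rw [mul_sum, ← sum_add_distrib]
    refine sum_le_sum fun p hp => ?_
    have hp0 : (0 : ℝ) < p := by exact_mod_cast (Nat.mem_primesLE.1 hp).2.pos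
    have h4 : (n : ℝ) / p ≤ (n / p : ℕ) + 1 := by
      have := Nat.lt_floor_add_one ((n : ℝ) / p)
      rw [Nat.floor_div_eq_div] at this
      exact this.le
    calc n * (Real.log p / p) = (n : ℝ) / p * Real.log p := by ring
      _ ≤ ((n / p : ℕ) + 1) * Real.log p := by
        have := Real.log_natCast_nonneg p
        gcongr
      _ = _ := by ring
  refine le_of_mul_le_mul_left ?_ hn'
  linarith

lemma sum_range_rpow_le {δ : ℝ} (hδ : 0 < δ) (n : ℕ) :
    ∑ k ∈ range n, (k : ℝ) ^ (-(1 + δ)) ≤ 1 + 1 / δ := by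
  have key : ∀ n : ℕ, ∑ k ∈ range (n + 2), (k : ℝ) ^ (-(1 + δ)) ≤
      1 + 1 / δ * (1 - ((n + 1 : ℕ) : ℝ) ^ (-δ)) := by
    intro n
    induction n with
    | zero =>
      have : (0 : ℝ) ^ (-(1 + δ)) = 0 := Real.zero_rpow (by linarith)
      simp [sum_range_succ, -neg_add_rev, this]
    | succ n ih =>
      rw [sum_range_succ]
      have hx : (0 : ℝ) < ((n + 1 : ℕ) : ℝ) := by positivity
      have hy : (0 : ℝ) < ((n + 2 : ℕ) : ℝ) := by positivity
      have hxy : ((n + 1 : ℕ) : ℝ) = (n + 2 : ℕ) * (1 - 1 / (n + 2 : ℕ)) := by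
        field_simp
        push_cast
        ring
      have hz : (0 : ℝ) < 1 - 1 / (n + 2 : ℕ) := by
        rw [hxy] at hx
        exact (mul_pos_iff_of_pos_left hy).1 hx
      have h1 : 1 + δ / (n + 2 : ℕ) ≤ (1 - 1 / (n + 2 : ℕ) : ℝ) ^ (-δ) := by
        rw [Real.rpow_def_of_pos hz]
        refine le_trans ?_ (Real.add_one_le_exp _)
        have h2 := Real.log_le_sub_one_of_pos hz
        have h3 : δ * Real.log (1 - 1 / (n + 2 : ℕ)) ≤ δ * (1 - 1 / (n + 2 : ℕ) - 1) := by gcongr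
        have h4 : δ / (n + 2 : ℕ) = -(δ * (1 - 1 / (n + 2 : ℕ) - 1)) := by ring
        linarith
      have h2 : ((n + 2 : ℕ) : ℝ) ^ (-δ) * (1 + δ / (n + 2 : ℕ)) ≤ ((n + 1 : ℕ) : ℝ) ^ (-δ) := by
        rw [hxy, Real.mul_rpow hy.le hz.le]
        gcongr
      have h3 : ((n + 2 : ℕ) : ℝ) ^ (-(1 + δ)) = ((n + 2 : ℕ) : ℝ) ^ (-δ) / (n + 2 : ℕ) := by
        rw [neg_add', show (-1 - δ : ℝ) = -δ - 1 by ring, Real.rpow_sub_one hy.ne']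
      have h4 : ((n + 2 : ℕ) : ℝ) ^ (-(1 + δ)) ≤
          1 / δ * (((n + 1 : ℕ) : ℝ) ^ (-δ) - ((n + 2 : ℕ) : ℝ) ^ (-δ)) := by
        rw [h3, one_div_mul_eq_div, le_div_iff₀ hδ]
        calc _ = ((n + 2 : ℕ) : ℝ) ^ (-δ) * (1 + δ / (n + 2 : ℕ)) - ((n + 2 : ℕ) : ℝ) ^ (-δ) := by
              ring
          _ ≤ _ := by linarith
      calc _ ≤ 1 + 1 / δ * (1 - ((n + 1 : ℕ) : ℝ) ^ (-δ)) +
            1 / δ * (((n + 1 : ℕ) : ℝ) ^ (-δ) - ((n + 2 : ℕ) : ℝ) ^ (-δ)) := add_le_add ih h4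
        _ = _ := by
          push_cast
          ring_nf
  calc _ ≤ ∑ k ∈ range (n + 2), (k : ℝ) ^ (-(1 + δ)) :=
        sum_le_sum_of_subset_of_nonneg (range_mono (by omega)) fun _ _ _ => by positivity
    _ ≤ _ := (key n).trans (by
      have : 0 ≤ 1 / δ * ((n + 1 : ℕ) : ℝ) ^ (-δ) := by positivity
      linarith)

lemma prod_primes_inv_le {δ : ℝ} (hδ : 0 < δ) {S : Finset ℕ} (hS : ∀ p ∈ S, p.Prime) :
    ∏ p ∈ S, (1 - (p : ℝ) ^ (-(1 + δ)))⁻¹ ≤ 1 + 1 / δ := by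
  let f : ℕ →* ℝ :=
    { toFun := fun n => (n : ℝ) ^ (-(1 + δ))
      map_one' := by simp
      map_mul' := fun m n => by
        rw [Nat.cast_mul, Real.mul_rpow (Nat.cast_nonneg m) (Nat.cast_nonneg n)] }
  have hf0 : ∀ n, 0 ≤ f n := fun n => Real.rpow_nonneg (Nat.cast_nonneg n) _
  have hf : ∀ {p : ℕ}, p.Prime → ‖f p‖ < 1 := fun {p} hp => by
    rw [Real.norm_of_nonneg (hf0 p)]
    exact Real.rpow_lt_one_of_one_lt_of_neg (by exact_mod_cast hp.one_lt) (by linarith)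
  obtain ⟨-, h⟩ := EulerProduct.summable_and_hasSum_factoredNumbers_prod_filter_prime_geometric hf S
  rw [filter_true_of_mem hS] at h
  have hsum : Summable fun n => f n :=
    Real.summable_nat_rpow.2 (by linarith)
  calc _ = ∑' m : Nat.factoredNumbers S, f m := h.tsum_eq.symm
    _ ≤ ∑' m : ℕ, f m := Summable.tsum_subtype_le _ _ hf0 hsum
    _ ≤ _ := Real.tsum_le_of_sum_range_le hf0 (sum_range_rpow_le hδ)

lemma inv_one_sub_inv_le {δ : ℝ} (hδ : 0 < δ) {p : ℕ} (hp : p.Prime) :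
    (1 - (p : ℝ)⁻¹)⁻¹ ≤
      (1 - (p : ℝ) ^ (-(1 + δ)))⁻¹ * Real.exp (δ * (Real.log p / (p - 1))) := by
  have hp1 : (1 : ℝ) < p := by exact_mod_cast hp.one_lt
  have hp0 : (0 : ℝ) < p := by linarith
  have hinv : (p : ℝ)⁻¹ < 1 := inv_lt_one_of_one_lt₀ hp1
  have h1 : (p : ℝ) ^ (-(1 + δ)) < 1 := Real.rpow_lt_one_of_one_lt_of_neg hp1 (by linarith)
  rw [inv_mul_eq_div, le_div_iff₀ (by linarith), inv_mul_le_iff₀ (by linarith)]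
  have h2 : (p : ℝ)⁻¹ * (1 - δ * Real.log p) ≤ (p : ℝ) ^ (-(1 + δ)) := by
    rw [neg_add, Real.rpow_add hp0, Real.rpow_neg_one, Real.rpow_def_of_pos hp0]
    gcongr
    have := Real.add_one_le_exp (Real.log p * -δ)
    linarith
  calc _ ≤ 1 - (p : ℝ)⁻¹ * (1 - δ * Real.log p) := by linarith
    _ = (1 - (p : ℝ)⁻¹) * (δ * (Real.log p / (p - 1)) + 1) := by
      have : (p : ℝ) - 1 ≠ 0 := by linarith
      field_simp
      ring
    _ ≤ _ := by
      have := Real.add_one_le_exp (δ * (Real.log p / (p - 1)))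
      have : 0 < 1 - (p : ℝ)⁻¹ := by linarith
      gcongr

lemma div_totient_eq {t : ℕ} (ht : t ≠ 0) :
    (t : ℝ) / t.totient = ∏ p ∈ t.primeFactors, (1 - (p : ℝ)⁻¹)⁻¹ := by
  have h : (t.totient : ℝ) = t * ∏ p ∈ t.primeFactors, (1 - (p : ℝ)⁻¹) := by
    have := congrArg (Rat.cast (K := ℝ)) (Nat.totient_eq_mul_prod_factors t)
    push_cast at this
    exact this
  have ht' : (t : ℝ) ≠ 0 := by exact_mod_cast ht
  rw [h, div_mul_cancel_left₀ ht', prod_inv_distrib]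

lemma div_totient_le_mul_exp {δ : ℝ} (hδ : 0 < δ) {t : ℕ} (ht : t ≠ 0) :
    (t : ℝ) / t.totient ≤
      (1 + 1 / δ) * Real.exp (δ * ∑ p ∈ t.primeFactors, Real.log p / (p - 1)) := by
  have hp : ∀ p ∈ t.primeFactors, p.Prime := fun p => Nat.prime_of_mem_primeFactors
  rw [div_totient_eq ht, mul_sum, Real.exp_sum]
  calc _ ≤ ∏ p ∈ t.primeFactors, ((1 - (p : ℝ) ^ (-(1 + δ)))⁻¹ *
        Real.exp (δ * (Real.log p / (p - 1)))) := by
        refine prod_le_prod (fun p h => ?_) fun p h => inv_one_sub_inv_le hδ (hp p h)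
        have : (p : ℝ)⁻¹ < 1 := inv_lt_one_of_one_lt₀ (by exact_mod_cast (hp p h).one_lt)
        exact inv_nonneg.2 (by linarith)
    _ ≤ _ := by
      rw [prod_mul_distrib]
      gcongr
      exact prod_primes_inv_le hδ hp

end TotientBounds

section TotientLogLog
open Topology

lemma prod_inv_le_card_add_one {S : Finset ℕ} (hS : ∀ p ∈ S, 2 ≤ p) :
    ∏ p ∈ S, (1 - (p : ℝ)⁻¹)⁻¹ ≤ #S + 1 ∧ (#S + 1).factorial ≤ ∏ p ∈ S, p := by
  induction S using Finset.induction_on_max with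
  | empty => simp
  | insert a s ha ih =>
    have has : a ∉ s := fun h => (ha a h).false
    obtain ⟨h1, h2⟩ := ih fun p hp => hS p (mem_insert_of_mem hp)
    have h3 : #s + 2 ≤ a := by
      have h4 : s ⊆ Ico 2 a := fun p hp => mem_Ico.2 ⟨hS p (mem_insert_of_mem hp), ha p hp⟩
      have h5 := card_le_card h4
      have h6 := hS a (mem_insert_self _ _)
      rw [Nat.card_Ico] at h5
      omega
    have h3' : (#s : ℝ) + 2 ≤ a := by exact_mod_cast h3
    have h0 : (0 : ℝ) ≤ #s := Nat.cast_nonneg _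
    rw [prod_insert has, prod_insert has, card_insert_of_notMem has]
    constructor
    · have h4 : (1 - (a : ℝ)⁻¹)⁻¹ ≤ ((#s : ℝ) + 2) / (#s + 1) := by
        rw [inv_le_comm₀ _ (by positivity), inv_div]
        · have h5 : (a : ℝ)⁻¹ ≤ ((#s : ℝ) + 2)⁻¹ := by gcongr
          have h6 : ((#s : ℝ) + 1) / (#s + 2) = 1 - ((#s : ℝ) + 2)⁻¹ := by
            field_simp
            ring
          linarith
        · have : (a : ℝ)⁻¹ < 1 := inv_lt_one_of_one_lt₀ (by linarith)
          linarith
      calc _ ≤ ((#s : ℝ) + 2) / (#s + 1) * (#s + 1) := by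
            refine mul_le_mul h4 h1 (prod_nonneg fun p hp => ?_) (by positivity)
            have : (p : ℝ)⁻¹ ≤ 1 := inv_le_one_of_one_le₀ (by
              exact_mod_cast (one_le_two.trans (hS p (mem_insert_of_mem hp))))
            exact inv_nonneg.2 (by linarith)
        _ = _ := by
          push_cast
          field_simp
          ring
    · rw [Nat.factorial_succ]
      exact Nat.mul_le_mul h3 h2

lemma div_totient_le_card_add_one {t : ℕ} (ht : t ≠ 0) :
    (t : ℝ) / t.totient ≤ #t.primeFactors + 1 ∧ (#t.primeFactors + 1).factorial ≤ t := by
  have h := prod_inv_le_card_add_one (S := t.primeFactors) fun p hp =>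
    (Nat.prime_of_mem_primeFactors hp).two_le
  rw [div_totient_eq ht]
  exact ⟨h.1, h.2.trans (Nat.le_of_dvd (Nat.pos_of_ne_zero ht) (Nat.prod_primeFactors_dvd t))⟩

lemma sum_log_div_sub_one_le {t : ℕ} (ht : Real.exp 90 ≤ t) :
    ∑ p ∈ t.primeFactors, Real.log p / (p - 1) ≤
      2 * Real.log (Real.log t) + 4 * Real.log 2 + 3 / 2 := by
  have ht0 : (0 : ℝ) < t := (Real.exp_pos _).trans_le ht
  have hl : 90 ≤ Real.log t := (Real.le_log_iff_exp_le ht0).2 ht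
  have htne : t ≠ 0 := by
    rintro rfl
    simp at ht0
  set n := ⌊Real.log t⌋₊ with hn
  have hn1 : (n : ℝ) ≤ Real.log t := Nat.floor_le (by linarith)
  have hn2 : Real.log t < n + 1 := Nat.lt_floor_add_one _
  have hn0 : (0 : ℝ) < n := by linarith
  have h1 : ∑ p ∈ t.primeFactors with p ≤ n, Real.log p / ((p : ℝ) - 1) ≤
      2 * (Real.log (Real.log t) + 2 * Real.log 2) := by
    calc _ ≤ ∑ p ∈ t.primeFactors with p ≤ n, 2 * (Real.log p / (p : ℝ)) := by
          refine sum_le_sum fun p hp => ?_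
          have hp2 : (2 : ℝ) ≤ p := by
            exact_mod_cast (Nat.prime_of_mem_primeFactors (mem_filter.1 hp).1).two_le
          have := Real.log_natCast_nonneg p
          rw [← mul_div_assoc, div_le_div_iff₀ (by linarith) (by linarith)]
          nlinarith
      _ ≤ ∑ p ∈ n.primesLE, 2 * (Real.log p / (p : ℝ)) := by
          refine sum_le_sum_of_subset_of_nonneg (fun p hp => ?_) fun p _ _ => ?_
          · rw [mem_filter] at hp
            exact Nat.mem_primesLE.2 ⟨hp.2, Nat.prime_of_mem_primeFactors hp.1⟩
          · have := Real.log_natCast_nonneg p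
            positivity
      _ ≤ _ := by
          rw [← mul_sum]
          gcongr
          refine (sum_log_div_primesLE_le (by exact_mod_cast hn0.ne')).trans ?_
          have : Real.log 4 = 2 * Real.log 2 := by
            rw [show (4 : ℝ) = 2 ^ 2 by norm_num, Real.log_pow]
            norm_num
          have := Real.log_le_log hn0 hn1
          linarith
  have h2 : ∑ p ∈ t.primeFactors with ¬ p ≤ n, Real.log p / ((p : ℝ) - 1) ≤ 3 / 2 := by
    calc _ ≤ ∑ p ∈ t.primeFactors with ¬ p ≤ n, Real.log p / n := by
          refine sum_le_sum fun p hp => ?_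
          have hp2 : (n : ℝ) + 1 ≤ p := by exact_mod_cast not_le.1 (mem_filter.1 hp).2
          have := Real.log_natCast_nonneg p
          gcongr
          linarith
      _ ≤ ∑ p ∈ t.primeFactors, Real.log p / n :=
          sum_le_sum_of_subset_of_nonneg (filter_subset _ _) fun p _ _ => by
            have := Real.log_natCast_nonneg p
            positivity
      _ ≤ Real.log t / n := by
          rw [← sum_div]
          gcongr
          have h3 : ∀ p ∈ t.primeFactors, (p : ℝ) ≠ 0 := fun p hp => by
            exact_mod_cast (Nat.prime_of_mem_primeFactors hp).ne_zero
          rw [← Real.log_prod h3]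
          refine Real.log_le_log (prod_pos fun p hp => by
            exact_mod_cast (Nat.prime_of_mem_primeFactors hp).pos) ?_
          rw [← Nat.cast_prod]
          exact_mod_cast Nat.le_of_dvd (Nat.pos_of_ne_zero htne) (Nat.prod_primeFactors_dvd t)
      _ ≤ 3 / 2 := by
          rw [div_le_iff₀ hn0]
          linarith
  rw [← sum_filter_add_sum_filter_not _ (fun p => p ≤ n)]
  linarith

lemma div_totient_lt_of_exp_le {t : ℕ} (ht : Real.exp 91 ≤ t) :
    (t : ℝ) / t.totient < 10 * Real.log (Real.log t) := by
  have ht0 : (0 : ℝ) < t := (Real.exp_pos _).trans_le ht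
  have hl : 91 ≤ Real.log t := (Real.le_log_iff_exp_le ht0).2 ht
  have htne : t ≠ 0 := by
    rintro rfl
    simp at ht0
  have hL : 9 / 2 ≤ Real.log (Real.log t) := by
    rw [Real.le_log_iff_exp_le (by linarith)]
    refine le_trans ?_ hl
    have h1 : Real.exp (9 / 2) ^ 2 = Real.exp 1 ^ 9 := by
      rw [← Real.exp_nat_mul, ← Real.exp_nat_mul]
      norm_num
    have h2 : Real.exp 1 ^ 9 ≤ 2.7182818286 ^ 9 := by
      have := Real.exp_one_lt_d9.le
      gcongr
    refine le_of_pow_le_pow_left₀ two_ne_zero (by norm_num) (h1.trans_le (h2.trans ?_))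
    norm_num
  have hsum := sum_log_div_sub_one_le ((Real.exp_le_exp.2 (by norm_num)).trans ht)
  set L := Real.log (Real.log t) with hLdef
  have h := div_totient_le_mul_exp (δ := 1 / (2 * L)) (by positivity) htne
  have hexp : 1 / (2 * L) * ∑ p ∈ t.primeFactors, Real.log p / ((p : ℝ) - 1) ≤ 3 / 2 := by
    rw [one_div_mul_eq_div, div_le_iff₀ (by positivity)]
    have := Real.log_two_lt_d9
    linarith
  have he : Real.exp (3 / 2) < 449 / 100 := by
    have h1 : Real.exp (3 / 2) ^ 2 = Real.exp 1 ^ 3 := by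
      rw [← Real.exp_nat_mul, ← Real.exp_nat_mul]
      norm_num
    have h2 : Real.exp 1 ^ 3 ≤ 2.7182818286 ^ 3 := by
      have := Real.exp_one_lt_d9.le
      gcongr
    refine lt_of_pow_lt_pow_left₀ 2 (by norm_num) (h1.trans_lt (h2.trans_lt ?_))
    norm_num
  rw [one_div_one_div] at h
  calc _ ≤ (1 + 2 * L) * Real.exp (3 / 2) := h.trans (by gcongr)
    _ ≤ (1 + 2 * L) * (449 / 100) := by gcongr
    _ < 10 * L := by linarith

lemma lt_log_log_of_lt {t m k : ℕ} {x : ℝ} (hx : Real.exp x ≤ k) (hk : 2.7182818286 ^ k < 2 * (m : ℝ))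
    (ht : m ≤ t) : x < Real.log (Real.log (2 * t)) := by
  have hk0 : (0 : ℝ) < k := (Real.exp_pos x).trans_le hx
  have h1 : Real.exp k < 2 * t := by
    rw [← Real.exp_one_pow]
    have h2 : Real.exp 1 ^ k ≤ 2.7182818286 ^ k := by
      have := Real.exp_one_lt_d9.le
      gcongr
    have h3 : (m : ℝ) ≤ t := by exact_mod_cast ht
    linarith
  have h2 : (k : ℝ) < Real.log (2 * t) :=
    (Real.lt_log_iff_exp_lt ((Real.exp_pos _).trans h1)).2 h1
  exact (Real.lt_log_iff_exp_lt (hk0.trans h2)).2 (hx.trans_lt h2)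

/-- An explicit form of the bound `t / φ(t) ≪ log log t`. -/
lemma div_totient_lt {t : ℕ} (ht : 1 < t) :
    (t : ℝ) / t.totient < 10 * Real.log (Real.log (2 * t)) := by
  obtain ⟨h1, h2⟩ := div_totient_le_card_add_one (t := t) (by omega)
  have hm2 : 2 ≤ #t.primeFactors + 1 := by
    have := (Nat.nonempty_primeFactors.2 ht).card_pos
    omega
  have h1' : (t : ℝ) / t.totient ≤ ((#t.primeFactors + 1 : ℕ) : ℝ) := by exact_mod_cast h1
  generalize #t.primeFactors + 1 = m at *
  have hexp : ∀ k : ℕ, Real.exp k ≤ 2.7182818286 ^ k := fun k => by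
    rw [← Real.exp_one_pow]
    have := Real.exp_one_lt_d9.le
    gcongr
  have key : ∀ (M K k : ℕ) (x : ℝ), M ≤ m → m ≤ K → (K : ℝ) ≤ 10 * x → Real.exp x ≤ k →
      2.7182818286 ^ k < 2 * (M.factorial : ℝ) →
      (t : ℝ) / t.totient < 10 * Real.log (Real.log (2 * t)) := by
    intro M K k x hM hK hx hk hM'
    have h3 := lt_log_log_of_lt hk hM' ((Nat.factorial_le hM).trans h2)
    have h4 : (m : ℝ) ≤ K := by exact_mod_cast hK
    linarith
  have hsmall : Real.exp (3 / 10) ≤ (2 : ℕ) := by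
    have := Real.exp_bound_div_one_sub_of_interval (x := 3 / 10) (by norm_num) (by norm_num)
    norm_num at this ⊢
    linarith
  rcases lt_or_ge 40 m with hm | hm
  · have h41 : Real.exp 91 ≤ t := by
      have h3 : (Nat.factorial 41 : ℝ) ≤ t := by exact_mod_cast (Nat.factorial_le hm).trans h2
      refine le_trans ?_ h3
      refine (hexp 91).trans ?_
      norm_num [Nat.factorial]
    refine (div_totient_lt_of_exp_le h41).trans_le ?_
    have ht0 : (0 : ℝ) < t := (Real.exp_pos _).trans_le h41
    have : 91 ≤ Real.log t := (Real.le_log_iff_exp_le ht0).2 h41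
    gcongr
    linarith
  rcases lt_or_ge 30 m with hm3 | hm3
  · exact key 31 40 55 4 hm3 hm (by norm_num) ((hexp 4).trans (by norm_num))
      (by norm_num [Nat.factorial])
  rcases lt_or_ge 20 m with hm4 | hm4
  · exact key 21 30 21 3 hm4 hm3 (by norm_num) ((hexp 3).trans (by norm_num))
      (by norm_num [Nat.factorial])
  rcases lt_or_ge 10 m with hm5 | hm5
  · exact key 11 20 8 2 hm5 hm4 (by norm_num) ((hexp 2).trans (by norm_num))
      (by norm_num [Nat.factorial])
  rcases lt_or_ge 3 m with hm6 | hm6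
  · exact key 4 10 3 1 hm6 hm5 (by norm_num) (by
      have := Real.exp_one_lt_d9
      norm_num
      linarith)
      (by norm_num [Nat.factorial])
  rcases lt_or_ge 2 m with hm7 | hm7
  · exact key 3 3 2 (3 / 10) hm7 hm6 (by norm_num) hsmall (by norm_num [Nat.factorial])
  · have h3 : Real.exp (1 / 5) < Real.log (2 * t) := by
      have h4 := Real.exp_bound_div_one_sub_of_interval (x := 1 / 5) (by norm_num) (by norm_num)
      have h5 := Real.log_two_gt_d9
      have h6 : Real.log 2 ≤ Real.log t := Real.log_le_log two_pos (by exact_mod_cast ht)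
      rw [Real.log_mul two_ne_zero (by positivity)]
      norm_num at h4
      linarith
    have h4 := (Real.lt_log_iff_exp_lt ((Real.exp_pos _).trans h3)).2 h3
    have h5 : (m : ℝ) ≤ 2 := by exact_mod_cast hm7
    linarith

end TotientLogLog

/-- `liminf_{a→∞} (b(a) − a)/log a ≤ t(t+1)φ(t)`; moreover if `t > 1` and `r_i ≠ 0` for all
`i` coprime to `t`, the liminf is `< 20·log(log(2t))`; and if `r_i ≠ 0` for all `i`, it is
`≤ 2`. -/
theorem liminf_denominator_drop_upper_bounds
    (t : ℕ) (r : ℕ → ℤ) (ht : 1 ≤ t)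
    (hper : ∀ i, 1 ≤ i → r (i + t) = r i)
    (hnz : ∃ i, 1 ≤ i ∧ r i ≠ 0) :
    atTop.liminf (fun a : ℕ => ((bfun r a : ℝ) - a) / Real.log a) ≤
        (t : ℝ) * (t + 1) * (Nat.totient t) ∧
      ((1 < t ∧ ∀ i, 1 ≤ i → Nat.Coprime i t → r i ≠ 0) →
        atTop.liminf (fun a : ℕ => ((bfun r a : ℝ) - a) / Real.log a) <
          20 * Real.log (Real.log (2 * t))) ∧
      ((∀ i, 1 ≤ i → r i ≠ 0) →
        atTop.liminf (fun a : ℕ => ((bfun r a : ℝ) - a) / Real.log a) ≤ 2) := by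
  have : NeZero t := ⟨by omega⟩
  have hmul : ∀ k i, 1 ≤ i → r (i + t * k) = r i := by
    intro k
    induction k with
    | zero => simp
    | succ k ih =>
      intro i hi
      rw [Nat.mul_succ, ← add_assoc, hper _ (by omega), ih i hi]
  have hr : ∀ n, 1 ≤ n → r n = (fun x : ZMod t => r (x.val + t)) n := by
    intro n hn
    simp only [ZMod.val_natCast]
    rw [← hmul (n / t) (n % t + t) (by omega), ← hper n hn, add_right_comm, Nat.mod_add_div]
  set ρ : ZMod t → ℤ := fun x => r (x.val + t) with hρ
  set R : Finset (ZMod t) := univ.filter fun x => ρ x ≠ 0 with hRdef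
  have hR : ∀ x, x ∈ R ↔ ρ x ≠ 0 := fun x => by simp [hRdef]
  have hne : R.Nonempty := by
    obtain ⟨i, hi, h⟩ := hnz
    exact ⟨i, (hR _).2 (hr i hi ▸ h)⟩
  have hmain := liminf_bfun_sub_le hr hR hne
  have ht0 : (1 : ℝ) ≤ t := by exact_mod_cast ht
  have hφ : (1 : ℝ) ≤ t.totient := by exact_mod_cast Nat.totient_pos.2 ht
  refine ⟨hmain.trans ?_, fun ⟨ht1, h⟩ => hmain.trans_lt ?_, fun h => hmain.trans (le_of_eq ?_)⟩
  · have h1 : (1 : ℝ) ≤ #R := by exact_mod_cast hne.card_pos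
    calc 2 * (t : ℝ) / #R ≤ 2 * t := div_le_self (by positivity) h1
      _ ≤ t * (t + 1) * 1 := by nlinarith
      _ ≤ _ := by gcongr
  · have hcard : t.totient ≤ #R := by
      rw [← ZMod.card_units_eq_totient t, ← card_univ,
        ← card_image_of_injective univ (Units.val_injective (α := ZMod t))]
      refine card_le_card fun x hx => ?_
      obtain ⟨u, -, rfl⟩ := mem_image.1 hx
      refine (hR _).2 (h _ (by omega) ?_)
      simpa using ZMod.val_coe_unit_coprime u
    have h1 : 2 * (t : ℝ) / #R ≤ 2 * (t / t.totient) := by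
      rw [← mul_div_assoc]
      gcongr
    have := div_totient_lt ht1
    linarith
  · have : R = univ := eq_univ_of_forall fun x => (hR x).2 (h _ (by omega))
    rw [this, card_univ, ZMod.card]
    field_simp
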